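/- Every module in the category O_{S,θ} is both Noetherian and Artinian as a g-module; consequently every M ∈ O_{S,θ} admits a finite Jordan–Hölder (composition) series. -/

import Mathlib

namespace Paper

open scoped Classical

open Module

variable {L : Type*} [LieRing L] [LieAlgebra ℂ L]

/-- The weight space of a Lie module `M` for a functional `α` on the subalgebra `H`. -/
def wSpace (H : LieSubalgebra ℂ L) {M : Type*} [AddCommGroup M] [Module ℂ M]
    [LieRingModule L M] [LieModule ℂ L M] (α : Module.Dual ℂ H) : Submodule ℂ M where
  carrier := {m | ∀ h : H, ⁅(h : L), m⁆ = α h • m}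
  add_mem' := by
    intro x y hx hy h
    rw [lie_add, hx h, hy h, smul_add]
  zero_mem' := by intro h; rw [lie_zero, smul_zero]
  smul_mem' := by
    intro c x hx h
    rw [lie_smul, hx h, smul_comm]

/-- The root space `g^α`. -/
def gSpace (H : LieSubalgebra ℂ L) (α : Module.Dual ℂ H) : Submodule ℂ L :=
  wSpace H α

/-- `α` is a root of `(L, H)` : a nonzero functional with nonzero root space. -/
def IsRoot (H : LieSubalgebra ℂ L) (α : Module.Dual ℂ H) : Prop :=
  α ≠ 0 ∧ gSpace H α ≠ ⊥

/-- `Δ` is a base (set of simple roots) of the root system of `(L, H)`: a linearly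
independent set of roots such that every root is a linear combination of elements of `Δ`
with coefficients that are all nonnegative integers or all nonpositive integers. -/
def IsBase (H : LieSubalgebra ℂ L) (Δ : Finset (Module.Dual ℂ H)) : Prop :=
  (∀ β ∈ Δ, IsRoot H β) ∧
  LinearIndependent ℂ (fun β : Δ => (β : Module.Dual ℂ H)) ∧
  ∀ α, IsRoot H α →
    (∃ c : Module.Dual ℂ H → ℕ, α = ∑ β ∈ Δ, (c β : ℂ) • β) ∨
    (∃ c : Module.Dual ℂ H → ℕ, α = -∑ β ∈ Δ, (c β : ℂ) • β)

/-- `α` is a positive root with respect to the base `Δ`. -/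
def IsPos (H : LieSubalgebra ℂ L) (Δ : Finset (Module.Dual ℂ H))
    (α : Module.Dual ℂ H) : Prop :=
  IsRoot H α ∧ ∃ c : Module.Dual ℂ H → ℕ, α = ∑ β ∈ Δ, (c β : ℂ) • β

/-- `α ∈ ⟨θ⟩` : `α` is a root which is a (ℤ-)linear combination of elements of `θ`. -/
def InSpan (H : LieSubalgebra ℂ L) (θ : Finset (Module.Dual ℂ H))
    (α : Module.Dual ℂ H) : Prop :=
  IsRoot H α ∧ ∃ c : Module.Dual ℂ H → ℤ, α = ∑ β ∈ θ, (c β : ℂ) • β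

/-- The nilradical `n⁺_θ = ⨁_{α ∈ R⁺ \ ⟨θ⟩⁺} g^α` (as a subspace of `L`). -/
def nPlus (H : LieSubalgebra ℂ L) (Δ θ : Finset (Module.Dual ℂ H)) : Submodule ℂ L :=
  ⨆ α ∈ {α | IsPos H Δ α ∧ ¬ InSpan H θ α}, gSpace H α

/-- The standard Levi subalgebra `l_θ = h ⊕ ⨁_{α ∈ ⟨θ⟩} g^α` (as a subspace of `L`). -/
def levi (H : LieSubalgebra ℂ L) (θ : Finset (Module.Dual ℂ H)) : Submodule ℂ L :=
  (H : Submodule ℂ L) ⊔ ⨆ α ∈ {α | InSpan H θ α}, gSpace H α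

/-- The standard parabolic subalgebra `p_θ = l_θ ⊕ n⁺_θ` (as a subspace of `L`). -/
def par (H : LieSubalgebra ℂ L) (Δ θ : Finset (Module.Dual ℂ H)) : Submodule ℂ L :=
  levi H θ ⊔ nPlus H Δ θ

section Modules

variable (H : LieSubalgebra ℂ L) (M : Type*) [AddCommGroup M] [Module ℂ M]
  [LieRingModule L M] [LieModule ℂ L M]

/-- `M` is a weight module: finitely generated, `h`-diagonalizable, with
finite-dimensional weight spaces. -/
def IsWeightModule : Prop :=
  (∃ s : Finset M, LieSubmodule.lieSpan ℂ L (s : Set M) = ⊤) ∧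
  (⨆ α : Module.Dual ℂ H, wSpace H (M := M) α) = ⊤ ∧
  ∀ α : Module.Dual ℂ H, FiniteDimensional ℂ (wSpace H (M := M) α)

/-- The root `α` is locally nilpotent with respect to `M`. -/
def IsLocallyNilpotentRoot (α : Module.Dual ℂ H) : Prop :=
  ∀ x ∈ gSpace H α, ∀ m : M, ∃ n : ℕ, ((LieModule.toEnd ℂ L M x) ^ n) m = 0

/-- The root `α` is cuspidal (injective) with respect to `M`. -/
def IsCuspidalRoot (α : Module.Dual ℂ H) : Prop :=
  ∀ x ∈ gSpace H α, x ≠ 0 → Function.Injective (LieModule.toEnd ℂ L M x)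

end Modules


/-- `W` is stable under the action of the Levi subalgebra `l_θ`. -/
def lStable (H : LieSubalgebra ℂ L) (θ : Finset (Module.Dual ℂ H)) {M : Type*}
    [AddCommGroup M] [Module ℂ M] [LieRingModule L M] [LieModule ℂ L M]
    (W : Submodule ℂ M) : Prop :=
  ∀ x ∈ levi H θ, ∀ m ∈ W, ⁅x, m⁆ ∈ W

/-- `W` is a simple highest weight `l_θ`-submodule of `M`: it is a nonzero
`l_θ`-stable subspace with no proper nonzero `l_θ`-stable subspace, generated
over `l_θ` by a weight vector annihilated by all `g^α`, `α ∈ ⟨θ⟩⁺`. -/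
def IsSimpleHW (H : LieSubalgebra ℂ L) (Δ θ : Finset (Module.Dual ℂ H)) {M : Type*}
    [AddCommGroup M] [Module ℂ M] [LieRingModule L M] [LieModule ℂ L M]
    (W : Submodule ℂ M) : Prop :=
  W ≠ ⊥ ∧ lStable H θ W ∧
  (∀ W' : Submodule ℂ M, W' ≤ W → lStable H θ W' → W' = ⊥ ∨ W' = W) ∧
  ∃ (lam : Module.Dual ℂ H) (v : M), v ∈ W ∧ v ≠ 0 ∧ v ∈ wSpace H lam ∧
    (∀ α, InSpan H θ α → IsPos H Δ α → ∀ x ∈ gSpace H α, ⁅x, v⁆ = 0) ∧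
    (∀ W' : Submodule ℂ M, lStable H θ W' → v ∈ W' → W ≤ W')

/-- `M` is an object of the category `O_{S,θ}` : a weight module which
(O1) decomposes as a direct sum of simple highest weight `l_θ`-modules,
(O2) on which `X_α` acts injectively for every `α ∈ ⟨S - θ⟩`, and
(O3) which is `n⁺_S`-finite. -/
def InO (H : LieSubalgebra ℂ L) (Δ S θ : Finset (Module.Dual ℂ H)) (M : Type*)
    [AddCommGroup M] [Module ℂ M] [LieRingModule L M] [LieModule ℂ L M] : Prop :=
  IsWeightModule H M ∧
  (∃ (ι : Type) (f : ι → Submodule ℂ M),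
      iSupIndep f ∧ (⨆ i, f i) = ⊤ ∧ ∀ i, IsSimpleHW H Δ θ (f i)) ∧
  (∀ α, InSpan H (S \ θ) α → IsCuspidalRoot H M α) ∧
  (∀ m : M, ∃ Wf : Submodule ℂ M, m ∈ Wf ∧ FiniteDimensional ℂ Wf ∧
      ∀ x ∈ nPlus H Δ S, ∀ w ∈ Wf, ⁅x, w⁆ ∈ Wf)

section Noeth

theorem noeth_aux_comm {k A : Type*} [Field k] [Ring A] [Algebra k A] (F : Submodule k A)
    (hF : ∀ y ∈ F, ∀ z ∈ F, y * z - z * y ∈ F) (n : ℕ) :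
    ∀ y ∈ F, ∀ z ∈ F ^ n, y * z - z * y ∈ F ^ n := by
  induction n with
  | zero =>
    intro y _ z hz
    rw [pow_zero, Submodule.mem_one] at hz
    obtain ⟨c, rfl⟩ := hz
    rw [Algebra.commutes, sub_self]; exact zero_mem _
  | succ n ih =>
    intro y hy z hz
    rw [pow_succ'] at hz ⊢
    induction hz using Submodule.mul_induction_on' with
    | mem_mul_mem a ha b hb =>
      have : y * (a * b) - a * b * y = (y * a - a * y) * b + a * (y * b - b * y) := by noncomm_ring
      rw [this]
      exact add_mem (Submodule.mul_mem_mul (hF y hy a ha) hb)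
        (Submodule.mul_mem_mul ha (ih y hy b hb))
    | add a _ b _ h1 h2 =>
      have : y * (a + b) - (a + b) * y = (y * a - a * y) + (y * b - b * y) := by noncomm_ring
      rw [this]; exact add_mem h1 h2

/-- ordered monomials along a list -/
def ordMono {A : Type*} [Ring A] {d : ℕ} (x : Fin d → A) (l : List (Fin d)) (a : Fin d →₀ ℕ) : A :=
  (l.map fun i => x i ^ a i).prod

theorem ordMono_mem {k A : Type*} [Field k] [Ring A] [Algebra k A] (F : Submodule k A) {d : ℕ}
    (x : Fin d → A) (hx : ∀ i, x i ∈ F) (a : Fin d →₀ ℕ) (l : List (Fin d)) :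
    ordMono x l a ∈ F ^ ((l.map a).sum) := by
  induction l with
  | nil => simp [ordMono, Submodule.mem_one]; exact ⟨1, by simp⟩
  | cons i l ih =>
    simp only [ordMono, List.map_cons, List.prod_cons, List.sum_cons, pow_add] at ih ⊢
    exact Submodule.mul_mem_mul (Submodule.pow_mem_pow _ (hx i) _) ih

theorem ordMono_move {k A : Type*} [Field k] [Ring A] [Algebra k A] (F : Submodule k A)
    (hF : ∀ y ∈ F, ∀ z ∈ F, y * z - z * y ∈ F) {d : ℕ}
    (x : Fin d → A) (hx : ∀ i, x i ∈ F) (a : Fin d →₀ ℕ) (j : Fin d) (l : List (Fin d))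
    (hl : l.Nodup) (hj : j ∈ l) :
    x j * ordMono x l a - ordMono x l (a + Finsupp.single j 1) ∈ F ^ ((l.map a).sum) := by
  induction l with
  | nil => simp at hj
  | cons i l ih =>
    rw [List.nodup_cons] at hl
    by_cases hij : i = j
    · subst hij
      have h1 : ordMono x l (a + Finsupp.single i 1) = ordMono x l a := by
        unfold ordMono
        congr 1
        apply List.map_congr_left
        intro m hm
        have : m ≠ i := by rintro rfl; exact hl.1 hm
        simp [this.symm]
      have h2 : ordMono x (i :: l) (a + Finsupp.single i 1)
          = x i ^ (a i + 1) * ordMono x l (a + Finsupp.single i 1) := by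
        simp [ordMono]
      have h3 : ordMono x (i :: l) a = x i ^ (a i) * ordMono x l a := by simp [ordMono]
      rw [h2, h1, h3, ← mul_assoc, ← pow_succ', sub_self]
      exact zero_mem _
    · have hj' : j ∈ l := by
        rcases List.mem_cons.1 hj with h | h
        · exact absurd h.symm hij
        · exact h
      have h2 : ordMono x (i :: l) (a + Finsupp.single j 1)
          = x i ^ (a i) * ordMono x l (a + Finsupp.single j 1) := by
        simp [ordMono, Finsupp.single_apply, Ne.symm hij]
      have h3 : ordMono x (i :: l) a = x i ^ (a i) * ordMono x l a := by simp [ordMono]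
      rw [h2, h3]
      have : x j * (x i ^ a i * ordMono x l a) - x i ^ a i * ordMono x l (a + Finsupp.single j 1)
          = (x j * x i ^ a i - x i ^ a i * x j) * ordMono x l a
            + x i ^ a i * (x j * ordMono x l a - ordMono x l (a + Finsupp.single j 1)) := by
        noncomm_ring
      rw [this, List.map_cons, List.sum_cons, pow_add]
      refine add_mem (Submodule.mul_mem_mul ?_ (ordMono_mem F x hx a l))
        (Submodule.mul_mem_mul (Submodule.pow_mem_pow _ (hx i) _) (ih hl.2 hj'))
      exact noeth_aux_comm F hF _ _ (hx j) _ (Submodule.pow_mem_pow _ (hx i) _)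

theorem noeth_generic {k A : Type*} [Field k] [Ring A] [Algebra k A] {d : ℕ} (x : Fin d → A)
    (hF : ∀ i j, x i * x j - x j * x i ∈ Submodule.span k (insert 1 (Set.range x)))
    (htop : Algebra.adjoin k (Set.range x) = ⊤) : IsNoetherianRing A := by
  classical
  set F : Submodule k A := Submodule.span k (insert 1 (Set.range x)) with hFdef
  have hx : ∀ i, x i ∈ F := fun i => Submodule.subset_span (Or.inr ⟨i, rfl⟩)
  have h1F : (1 : A) ∈ F := Submodule.subset_span (Or.inl rfl)
  have hFF : ∀ y ∈ F, ∀ z ∈ F, y * z - z * y ∈ F := by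
    intro y hy z hz
    induction hy using Submodule.span_induction with
    | mem y hy =>
      induction hz using Submodule.span_induction with
      | mem z hz =>
        rcases hy with rfl | ⟨i, rfl⟩
        · simp
        · rcases hz with rfl | ⟨j, rfl⟩
          · simp
          · exact hF i j
      | zero => simp
      | add a b _ _ ha hb =>
        have : y * (a + b) - (a + b) * y = (y * a - a * y) + (y * b - b * y) := by noncomm_ring
        rw [this]; exact add_mem ha hb
      | smul c a _ ha =>
        rw [mul_smul_comm, smul_mul_assoc, ← smul_sub]; exact F.smul_mem _ ha
    | zero => simp
    | add a b _ _ ha hb =>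
      have : (a + b) * z - z * (a + b) = (a * z - z * a) + (b * z - z * b) := by noncomm_ring
      rw [this]; exact add_mem ha hb
    | smul c a _ ha =>
      rw [mul_smul_comm, smul_mul_assoc, ← smul_sub]; exact F.smul_mem _ ha
  have hle : ∀ n, F ^ n ≤ F ^ (n + 1) := by
    intro n z hz
    rw [pow_succ]
    simpa using Submodule.mul_mem_mul hz h1F
  have hmono : Monotone (fun n => F ^ n) := monotone_nat_of_le_succ hle
  let mo : (Fin d →₀ ℕ) → A := ordMono x (List.finRange d)
  have hdeg : ∀ a : Fin d →₀ ℕ, ((List.finRange d).map a).sum = a.degree := by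
    intro a
    rw [Finsupp.degree_eq_sum, ← List.sum_ofFn, List.ofFn_eq_map]
  let φ : MvPolynomial (Fin d) k →ₗ[k] A := (MvPolynomial.basisMonomials (Fin d) k).constr k mo
  have hφ : ∀ a c, φ (MvPolynomial.monomial a c) = c • mo a := by
    intro a c
    have : MvPolynomial.monomial a c = c • MvPolynomial.basisMonomials (Fin d) k a := by
      simp [MvPolynomial.smul_monomial]
    rw [this, map_smul, Module.Basis.constr_basis]
  -- filtration
  have hφmem : ∀ n (p : MvPolynomial (Fin d) k), p.totalDegree ≤ n → φ p ∈ F ^ n := by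
    intro n p hp
    rw [p.as_sum, map_sum]
    refine sum_mem fun a ha => ?_
    rw [hφ]
    refine Submodule.smul_mem _ _ (hmono ?_ (hdeg a ▸ ordMono_mem F x hx a (List.finRange d)))
    refine le_trans ?_ hp
    have := MvPolynomial.le_totalDegree ha
    exact this
  have hmove : ∀ n (p : MvPolynomial (Fin d) k) j, p.totalDegree ≤ n →
      x j * φ p - φ (MvPolynomial.X j * p) ∈ F ^ n := by
    intro n p j hp
    have key : x j * φ p - φ (MvPolynomial.X j * p) = ∑ a ∈ p.support,
        p.coeff a • (x j * mo a - mo (a + Finsupp.single j 1)) := by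
      conv_lhs => rw [p.as_sum, Finset.mul_sum, map_sum, map_sum, Finset.mul_sum,
        ← Finset.sum_sub_distrib]
      refine Finset.sum_congr rfl fun a ha => ?_
      rw [hφ, mul_comm (MvPolynomial.X j), MvPolynomial.X, MvPolynomial.monomial_mul, hφ,
        mul_smul_comm, smul_sub, mul_one]
    rw [key]
    refine sum_mem fun a ha => Submodule.smul_mem _ _ (hmono ?_ (hdeg a ▸ ordMono_move F hFF x hx a j
      (List.finRange d) (List.nodup_finRange d) (List.mem_finRange j)))
    refine le_trans ?_ hp
    have := MvPolynomial.le_totalDegree ha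
    exact this
  have hsurj : ∀ n, ∀ z ∈ F ^ n, ∃ p : MvPolynomial (Fin d) k, p.totalDegree ≤ n ∧ φ p = z := by
    intro n
    induction n with
    | zero =>
      intro z hz
      rw [pow_zero, Submodule.mem_one] at hz
      obtain ⟨c, rfl⟩ := hz
      refine ⟨MvPolynomial.monomial 0 c, by simp, ?_⟩
      rw [hφ, Algebra.algebraMap_eq_smul_one]
      congr 1
      simp [mo, ordMono]
    | succ n ih =>
      intro z hz
      rw [pow_succ'] at hz
      induction hz using Submodule.mul_induction_on' with
      | mem_mul_mem a ha b hb =>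
        obtain ⟨p, hp, rfl⟩ := ih b hb
        induction ha using Submodule.span_induction with
        | mem y hy =>
          rcases hy with rfl | ⟨i, rfl⟩
          · exact ⟨p, by omega, by simp⟩
          · obtain ⟨q, hq, hq'⟩ := ih _ (hmove n p i hp)
            refine ⟨MvPolynomial.X i * p + q, ?_, ?_⟩
            · refine (MvPolynomial.totalDegree_add _ _).trans (max_le ?_ (by omega))
              refine (MvPolynomial.totalDegree_mul _ _).trans ?_
              rw [MvPolynomial.totalDegree_X]; omega
            · rw [map_add, hq']; abel
        | zero => exact ⟨0, by simp, by simp⟩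
        | add a b _ _ ha hb =>
          obtain ⟨p1, h1, h1'⟩ := ha
          obtain ⟨p2, h2, h2'⟩ := hb
          exact ⟨p1 + p2, (MvPolynomial.totalDegree_add _ _).trans (max_le h1 h2),
            by rw [map_add, h1', h2', add_mul]⟩
        | smul c a _ ha =>
          obtain ⟨p1, h1, h1'⟩ := ha
          exact ⟨c • p1, (MvPolynomial.totalDegree_smul_le _ _).trans h1,
            by rw [map_smul, h1', smul_mul_assoc]⟩
      | add a _ b _ ha hb =>
          obtain ⟨p1, h1, h1'⟩ := ha
          obtain ⟨p2, h2, h2'⟩ := hb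
          exact ⟨p1 + p2, (MvPolynomial.totalDegree_add _ _).trans (max_le h1 h2),
            by rw [map_add, h1', h2']⟩
  have hex : ∀ z : A, ∃ n, z ∈ F ^ n := by
    intro z
    have hz : z ∈ Algebra.adjoin k (Set.range x) := by rw [htop]; trivial
    induction hz using Algebra.adjoin_induction with
    | mem y hy => exact ⟨1, by obtain ⟨i, rfl⟩ := hy; simpa using hx i⟩
    | algebraMap c => exact ⟨0, by rw [pow_zero, Submodule.mem_one]; exact ⟨c, rfl⟩⟩
    | add a b _ _ ha hb =>
      obtain ⟨n, hn⟩ := ha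
      obtain ⟨m, hm⟩ := hb
      exact ⟨max n m, add_mem (hmono (le_max_left _ _) hn) (hmono (le_max_right _ _) hm)⟩
    | mul a b _ _ ha hb =>
      obtain ⟨n, hn⟩ := ha
      obtain ⟨m, hm⟩ := hb
      exact ⟨n + m, by rw [pow_add]; exact Submodule.mul_mem_mul hn hm⟩
  let G : ℕ → Submodule k A := fun n => match n with | 0 => ⊥ | n + 1 => F ^ n
  have hG : ∀ n j, ∀ g ∈ G n, x j * g ∈ F ^ n := by
    intro n j g hg
    cases n with
    | zero =>
      have : g = 0 := by simpa [G] using hg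
      simp [this]
    | succ n => rw [pow_succ']; exact Submodule.mul_mem_mul (hx j) hg
  -- symbol submodule
  have hcX : ∀ n j (p : MvPolynomial (Fin d) k), MvPolynomial.homogeneousComponent (n + 1)
      (MvPolynomial.X j * p) = MvPolynomial.X j * MvPolynomial.homogeneousComponent n p := by
    intro n j p
    ext a
    rw [MvPolynomial.coeff_homogeneousComponent, MvPolynomial.coeff_X_mul',
      MvPolynomial.coeff_X_mul', MvPolynomial.coeff_homogeneousComponent]
    by_cases hj : j ∈ a.support
    · have hja : a = (a - Finsupp.single j 1) + Finsupp.single j 1 := by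
        rw [tsub_add_cancel_of_le]
        simpa [Nat.one_le_iff_ne_zero] using hj
      have : a.degree = (a - Finsupp.single j 1).degree + 1 := by
        conv_lhs => rw [hja]
        simp
      simp only [hj, if_true, this, Nat.add_right_cancel_iff]
    · simp [hj]
  have hcX0 : ∀ j (p : MvPolynomial (Fin d) k), MvPolynomial.homogeneousComponent 0
      (MvPolynomial.X j * p) = 0 := by
    intro j p
    rw [MvPolynomial.homogeneousComponent_zero, MvPolynomial.coeff_X_mul']
    simp
  let J : Submodule A A → Submodule (MvPolynomial (Fin d) k) (MvPolynomial (Fin d) k) := fun N =>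
    { carrier := {p | ∀ n, φ (MvPolynomial.homogeneousComponent n p) ∈ N.restrictScalars k ⊔ G n}
      add_mem' := by
        intro p q hp hq n
        rw [map_add, map_add]; exact add_mem (hp n) (hq n)
      zero_mem' := by intro n; simp
      smul_mem' := by
        intro c
        induction c using MvPolynomial.induction_on with
        | C c =>
          intro p hp n
          rw [smul_eq_mul, MvPolynomial.homogeneousComponent_C_mul, ← MvPolynomial.smul_eq_C_mul, map_smul]
          exact Submodule.smul_mem _ _ (hp n)
        | add a b ha hb =>
          intro p hp n
          rw [add_smul, map_add, map_add]; exact add_mem (ha hp n) (hb hp n)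
        | mul_X a j ha =>
          intro p hp
          rw [mul_smul]
          apply ha
          intro n
          rw [smul_eq_mul]
          cases n with
          | zero => rw [hcX0]; simp
          | succ n =>
            rw [hcX]
            obtain ⟨u, hu, g, hg, hug⟩ := Submodule.mem_sup.1 (hp n)
            have h1 := hmove n (MvPolynomial.homogeneousComponent n p) j
              ((MvPolynomial.homogeneousComponent_isHomogeneous n p).totalDegree_le)
            have h2 : φ (MvPolynomial.X j * MvPolynomial.homogeneousComponent n p)
              = x j * u + (x j * g - (x j * φ (MvPolynomial.homogeneousComponent n p) -
                  φ (MvPolynomial.X j * MvPolynomial.homogeneousComponent n p))) := by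
              rw [← hug]; noncomm_ring
            rw [h2]
            exact Submodule.add_mem_sup (N.smul_mem (x j) hu) (sub_mem (hG n j g hg) h1) }
  have hJ : ∀ N p, p ∈ J N ↔ ∀ n, φ (MvPolynomial.homogeneousComponent n p) ∈ N.restrictScalars k ⊔ G n :=
    fun N p => Iff.rfl
  have hJmono : Monotone J := by
    intro N N' h p hp n
    exact (sup_le_sup_right (show N.restrictScalars k ≤ N'.restrictScalars k from h) (G n)) (hp n)
  have hJinj : ∀ N N', N ≤ N' → J N' ≤ J N → N' ≤ N := by
    intro N N' h hJJ
    have main : ∀ n, ∀ m ∈ G n, m ∈ N' → m ∈ N := by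
      intro n
      induction n with
      | zero => intro m hm _; have : m = 0 := by simpa [G] using hm
                rw [this]; exact zero_mem _
      | succ n ih =>
        intro m hm hm'
        obtain ⟨q, hq, rfl⟩ := hsurj n m hm
        set p := MvPolynomial.homogeneousComponent n q with hp
        have hpq : φ (q - p) ∈ G n := by
          have hsum : q - p = ∑ i ∈ Finset.range n, MvPolynomial.homogeneousComponent i q := by
            conv_lhs => rw [← MvPolynomial.sum_homogeneousComponent q]
            rw [sub_eq_iff_eq_add, ← Finset.sum_range_succ]
            refine Finset.sum_subset ?_ ?_
            · intro i hi; simp at hi ⊢; omega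
            · intro i _ hi
              apply MvPolynomial.homogeneousComponent_eq_zero
              simp at hi; omega
          rw [hsum]
          cases n with
          | zero => simp
          | succ n =>
            rw [map_sum]
            refine sum_mem fun i hi => hφmem n _ ?_
            refine (MvPolynomial.homogeneousComponent_isHomogeneous i q).totalDegree_le.trans ?_
            simp at hi; omega
        have hpJ : p ∈ J N' := by
          rw [hJ]
          intro i
          by_cases hi : i = n
          · subst hi
            rw [hp, MvPolynomial.homogeneousComponent_of_mem
              (MvPolynomial.homogeneousComponent_mem i q), if_pos rfl, ← hp]
            have : φ p = φ q + (- φ (q - p)) := by rw [map_sub]; abel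
            rw [this]
            exact Submodule.add_mem_sup hm' (neg_mem hpq)
          · rw [hp, MvPolynomial.homogeneousComponent_of_mem
              (MvPolynomial.homogeneousComponent_mem n q), if_neg hi]
            simp
        have hpN := (hJ N p).1 (hJJ hpJ) n
        rw [hp, MvPolynomial.homogeneousComponent_of_mem
              (MvPolynomial.homogeneousComponent_mem n q), if_pos rfl, ← hp] at hpN
        obtain ⟨u, hu, g, hg, hug⟩ := Submodule.mem_sup.1 hpN
        have hu' : u ∈ N := hu
        have e1 : φ q = u + (g + φ (q - p)) := by rw [map_sub, ← hug]; abel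
        have h3 : g + φ (q - p) ∈ N := by
          apply ih _ (add_mem hg hpq)
          have : g + φ (q - p) = φ q - u := by rw [e1]; abel
          rw [this]; exact sub_mem hm' (h hu')
        rw [e1]; exact add_mem hu' h3
    intro m hm
    obtain ⟨n, hn⟩ := hex m
    exact main (n + 1) m hn hm
  have hstrict : StrictMono J := by
    intro N N' h
    refine lt_of_le_not_ge (hJmono h.le) fun h' => ?_
    exact absurd (hJinj N N' h.le h') (not_le_of_gt h)
  rw [isNoetherianRing_iff, isNoetherian_iff']
  exact hstrict.wellFoundedGT


attribute [local instance] LieRing.ofAssociativeRing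

theorem noeth_uea {L : Type*} [LieRing L] [LieAlgebra ℂ L] [FiniteDimensional ℂ L] :
    IsNoetherianRing (UniversalEnvelopingAlgebra ℂ L) := by
  let b := Module.finBasis ℂ L
  have hι : ∀ y : L, UniversalEnvelopingAlgebra.ι ℂ y ∈ Submodule.span ℂ
      (Set.range fun i => UniversalEnvelopingAlgebra.ι ℂ (b i)) := by
    intro y
    rw [← b.sum_repr y, map_sum]
    refine sum_mem fun i _ => ?_
    rw [map_smul]
    exact Submodule.smul_mem _ _ (Submodule.subset_span ⟨i, rfl⟩)
  refine noeth_generic (k := ℂ) (fun i => UniversalEnvelopingAlgebra.ι ℂ (b i)) ?_ ?_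
  · intro i j
    have : UniversalEnvelopingAlgebra.ι ℂ (b i) * UniversalEnvelopingAlgebra.ι ℂ (b j)
      - UniversalEnvelopingAlgebra.ι ℂ (b j) * UniversalEnvelopingAlgebra.ι ℂ (b i)
      = UniversalEnvelopingAlgebra.ι ℂ ⁅b i, b j⁆ := by
      rw [LieHom.map_lie, LieRing.of_associative_ring_bracket]
    rw [this]
    exact Submodule.span_mono (Set.subset_insert _ _) (hι _)
  · set S := Algebra.adjoin ℂ (Set.range fun i => UniversalEnvelopingAlgebra.ι ℂ (b i)) with hS
    have hιS : ∀ y : L, UniversalEnvelopingAlgebra.ι ℂ y ∈ S := fun y =>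
      Algebra.span_le_adjoin ℂ _ (hι y)
    let g : L →ₗ⁅ℂ⁆ S :=
      { toFun := fun y => ⟨UniversalEnvelopingAlgebra.ι ℂ y, hιS y⟩
        map_add' := fun y z => by ext; simp
        map_smul' := fun c z => by ext; simp
        map_lie' := fun {y z} => by
          ext
          simp [LieRing.of_associative_ring_bracket] }
    have hcomp : S.val.comp (UniversalEnvelopingAlgebra.lift ℂ g) = AlgHom.id ℂ _ := by
      ext y
      simp [g]
    rw [eq_top_iff]
    intro z _
    have : S.val (UniversalEnvelopingAlgebra.lift ℂ g z) = z := DFunLike.congr_fun hcomp z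
    rw [← this]
    exact (UniversalEnvelopingAlgebra.lift ℂ g z).2

theorem lieSubmodule_noeth {L : Type*} [LieRing L] [LieAlgebra ℂ L] [FiniteDimensional ℂ L]
    (M : Type*) [AddCommGroup M] [Module ℂ M] [LieRingModule L M] [LieModule ℂ L M]
    (s : Finset M) (hs : LieSubmodule.lieSpan ℂ L (s : Set M) = ⊤) :
    WellFoundedGT (LieSubmodule ℂ L M) := by
  let A := UniversalEnvelopingAlgebra ℂ L
  let π : A →ₐ[ℂ] Module.End ℂ M := UniversalEnvelopingAlgebra.lift ℂ (LieModule.toEnd ℂ L M)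
  let : Module A M := Module.compHom M π.toRingHom
  have hsm : ∀ (a : A) (m : M), a • m = π a m := fun a m => rfl
  have hι : ∀ (y : L) (m : M), UniversalEnvelopingAlgebra.ι ℂ y • m = ⁅y, m⁆ := by
    intro y m; rw [hsm]; show (UniversalEnvelopingAlgebra.lift ℂ (LieModule.toEnd ℂ L M) (UniversalEnvelopingAlgebra.ι ℂ y)) m = _
    rw [UniversalEnvelopingAlgebra.lift_ι_apply]; rfl
  have : IsNoetherianRing A := noeth_uea
  -- Lie submodule to A-submodule
  have hstab : ∀ (N : LieSubmodule ℂ L M) (a : A), ∀ m ∈ N, a • m ∈ N := by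
    intro N a
    let S : Subalgebra ℂ A :=
      { carrier := {a | ∀ m ∈ N, a • m ∈ N}
        mul_mem' := fun {a b} ha hb m hm => by rw [mul_smul]; exact ha _ (hb _ hm)
        add_mem' := fun {a b} ha hb m hm => by rw [add_smul]; exact add_mem (ha _ hm) (hb _ hm)
        algebraMap_mem' := fun c m hm => by
          rw [hsm, AlgHom.commutes]; exact N.smul_mem c hm }
    have hιS : ∀ y : L, UniversalEnvelopingAlgebra.ι ℂ y ∈ S := fun y m hm => by
      rw [hι]; exact N.lie_mem hm
    let g : L →ₗ⁅ℂ⁆ S :=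
      { toFun := fun y => ⟨UniversalEnvelopingAlgebra.ι ℂ y, hιS y⟩
        map_add' := fun y z => by ext; simp
        map_smul' := fun c z => by ext; simp
        map_lie' := fun {y z} => by
          ext
          simp [LieRing.of_associative_ring_bracket] }
    have hcomp : S.val.comp (UniversalEnvelopingAlgebra.lift ℂ g) = AlgHom.id ℂ _ := by
      ext y
      simp [g]
      rfl
    have : S.val (UniversalEnvelopingAlgebra.lift ℂ g a) = a := DFunLike.congr_fun hcomp a
    rw [← this]
    exact (UniversalEnvelopingAlgebra.lift ℂ g a).2
  let T : LieSubmodule ℂ L M → Submodule A M := fun N =>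
    { carrier := N
      add_mem' := fun ha hb => add_mem ha hb
      zero_mem' := N.zero_mem
      smul_mem' := fun a m hm => hstab N a m hm }
  have hT : StrictMono T := by
    intro N N' h
    exact ⟨fun m hm => h.1 hm, fun h' => h.2 fun m hm => h' hm⟩
  have : Module.Finite A M := by
    refine ⟨⟨s, ?_⟩⟩
    let N : LieSubmodule ℂ L M :=
      { carrier := Submodule.span A (s : Set M)
        add_mem' := fun ha hb => add_mem ha hb
        zero_mem' := zero_mem _
        smul_mem' := fun c m hm => by
          have : c • m = (algebraMap ℂ A c) • m := by rw [hsm, AlgHom.commutes]; rfl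
          rw [this]
          exact Submodule.smul_mem _ _ hm
        lie_mem := fun {y m} hm => by
          rw [← hι]; exact Submodule.smul_mem _ _ hm }
    have hN : N = ⊤ := by
      rw [eq_top_iff, ← hs, LieSubmodule.lieSpan_le]
      exact fun m hm => Submodule.subset_span hm
    rw [eq_top_iff]
    intro m _
    have : m ∈ N := by rw [hN]; trivial
    exact this
  have : IsNoetherian A M := inferInstance
  have : WellFoundedGT (Submodule A M) := inferInstance
  exact hT.wellFoundedGT

end Noeth

section WM

variable {L : Type*} [LieRing L] [LieAlgebra ℂ L]

def IsRep {V : Type*} [AddCommGroup V] [Module ℂ V] (ρ : L →ₗ[ℂ] Module.End ℂ V) : Prop :=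
  ∀ x y v, ρ ⁅x, y⁆ v = ρ x (ρ y v) - ρ y (ρ x v)

def Stb {V : Type*} [AddCommGroup V] [Module ℂ V] (ρ : L →ₗ[ℂ] Module.End ℂ V)
    (W : Submodule ℂ V) : Prop := ∀ y, ∀ w ∈ W, ρ y w ∈ W

def rwt (H : LieSubalgebra ℂ L) {V : Type*} [AddCommGroup V] [Module ℂ V]
    (ρ : L →ₗ[ℂ] Module.End ℂ V) (l : Module.Dual ℂ H) : Submodule ℂ V where
  carrier := {m | ∀ h : H, ρ (h : L) m = l h • m}
  add_mem' := by
    intro x y hx hy h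
    rw [map_add, hx h, hy h, smul_add]
  zero_mem' := by intro h; rw [map_zero, smul_zero]
  smul_mem' := by
    intro c x hx h
    rw [map_smul, hx h, smul_comm]

def IsWt (H : LieSubalgebra ℂ L) {V : Type*} [AddCommGroup V] [Module ℂ V]
    (ρ : L →ₗ[ℂ] Module.End ℂ V) : Prop :=
  (⨆ l, rwt H ρ l) = ⊤ ∧ ∀ l, FiniteDimensional ℂ (rwt H ρ l)

variable {H : LieSubalgebra ℂ L} {V : Type*} [AddCommGroup V] [Module ℂ V]
  {ρ : L →ₗ[ℂ] Module.End ℂ V}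

theorem mem_rwt {l : Module.Dual ℂ H} {v : V} :
    v ∈ rwt H ρ l ↔ ∀ h : H, ρ (h : L) v = l h • v := Iff.rfl

theorem comp_mem (W : Submodule ℂ V) (hW : ∀ h : H, ∀ w ∈ W, ρ (h : L) w ∈ W)
    (s : Finset (Module.Dual ℂ H)) (f : Module.Dual ℂ H → V)
    (hf : ∀ l ∈ s, f l ∈ rwt H ρ l) (hs : ∑ l ∈ s, f l ∈ W) : ∀ l ∈ s, f l ∈ W := by
  classical
  induction s using Finset.induction_on generalizing f with
  | empty => simp
  | insert μ s hμ ih =>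
    have h1 : ∀ l ∈ s, f l ∈ W := by
      intro l hl
      have hne : l ≠ μ := by rintro rfl; exact hμ hl
      obtain ⟨h, hh⟩ : ∃ h, l h ≠ μ h := by
        by_contra! hcon; exact hne (LinearMap.ext hcon)
      have h2 := ih (fun l => (l h - μ h) • f l)
        (fun l hl => Submodule.smul_mem _ _ (hf l (Finset.mem_insert_of_mem hl))) (by
          have h3 := W.sub_mem (hW h _ hs) (W.smul_mem (μ h) hs)
          rw [map_sum, Finset.smul_sum, ← Finset.sum_sub_distrib, Finset.sum_insert hμ,
            hf μ (Finset.mem_insert_self _ _) h, sub_self, zero_add] at h3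
          convert h3 using 1
          refine Finset.sum_congr rfl fun l hl => ?_
          rw [hf l (Finset.mem_insert_of_mem hl) h, sub_smul]) l hl
      exact (W.smul_mem_iff (sub_ne_zero.2 hh)).1 h2
    intro l hl
    rcases Finset.mem_insert.1 hl with rfl | hl
    · rw [Finset.sum_insert hμ] at hs
      exact (W.add_mem_iff_left (sum_mem h1)).1 hs
    · exact h1 l hl

theorem exists_decomp (hwt : (⨆ l, rwt H ρ l) = ⊤) (v : V) :
    ∃ (s : Finset (Module.Dual ℂ H)) (f : Module.Dual ℂ H → V),
      (∀ l, f l ∈ rwt H ρ l) ∧ v = ∑ l ∈ s, f l := by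
  have hv : v ∈ ⨆ l, rwt H ρ l := by rw [hwt]; trivial
  rw [Submodule.mem_iSup_iff_exists_finsupp] at hv
  obtain ⟨f, hf, h⟩ := hv
  exact ⟨f.support, f, hf, by rw [← h]; rfl⟩

/-- A vector of weight `l` in a sum of weight spaces indexed by `S` has `l ∈ S`. -/
theorem wt_mem_of_mem_iSup (S : Set (Module.Dual ℂ H)) (l : Module.Dual ℂ H) (v : V)
    (hv0 : v ≠ 0) (hv : v ∈ rwt H ρ l) (hS : v ∈ ⨆ m : S, rwt H ρ (m : Module.Dual ℂ H)) :
    l ∈ S := by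
  classical
  by_contra hl
  rw [Submodule.mem_iSup_iff_exists_finsupp] at hS
  obtain ⟨f, hf, h⟩ := hS
  let g : Module.Dual ℂ H → V := fun m => if h : m ∈ S then f ⟨m, h⟩ else if m = l then - v else 0
  let s : Finset (Module.Dual ℂ H) := insert l (f.support.map (Function.Embedding.subtype _))
  have hls : l ∉ f.support.map (Function.Embedding.subtype _) := by
    intro h
    obtain ⟨m, _, rfl⟩ := Finset.mem_map.1 h
    exact hl m.2
  have hg : ∀ m ∈ s, g m ∈ rwt H ρ m := by
    intro m _
    by_cases hm : m ∈ S
    · simp only [g, hm, dif_pos]; exact hf ⟨m, hm⟩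
    · by_cases hml : m = l
      · subst hml; simp only [g, hm, dif_neg, not_false_eq_true, if_true]
        exact Submodule.neg_mem _ hv
      · simp [g, hm, hml]
  have hsum : ∑ m ∈ s, g m = 0 := by
    rw [Finset.sum_insert hls, Finset.sum_map]
    have : ∑ x ∈ f.support, g (Function.Embedding.subtype _ x) = v := by
      rw [← h]
      refine Finset.sum_congr rfl fun x _ => ?_
      simp [g]
    rw [this]; simp [g, hl]
  have := comp_mem (ρ := ρ) (H := H) ⊥ (fun h w hw => by
    rw [Submodule.mem_bot] at hw ⊢; rw [hw, map_zero]) s g hg (by rw [hsum]; exact zero_mem _)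
    l (Finset.mem_insert_self _ _)
  simp [g, hl] at this
  exact hv0 this

theorem Stb.exists_wt (hwt : (⨆ l, rwt H ρ l) = ⊤) {W : Submodule ℂ V} (hW : Stb ρ W)
    (h0 : W ≠ ⊥) : ∃ l, ∃ v ∈ W, v ≠ 0 ∧ v ∈ rwt H ρ l := by
  obtain ⟨v, hv, hv0⟩ := Submodule.exists_mem_ne_zero_of_ne_bot h0
  obtain ⟨s, f, hf, h⟩ := exists_decomp hwt v
  have := comp_mem W (fun h w hw => hW h w hw) s f (fun l _ => hf l) (h ▸ hv)
  by_contra! hcon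
  apply hv0
  rw [h]
  refine Finset.sum_eq_zero fun l hl => ?_
  by_contra h0
  exact hcon l (f l) (this l hl) h0 (hf l)

/-- restriction of a representation -/
def rres (ρ : L →ₗ[ℂ] Module.End ℂ V) (W : Submodule ℂ V) (hW : Stb ρ W) :
    L →ₗ[ℂ] Module.End ℂ W where
  toFun y := (ρ y).restrict (hW y)
  map_add' x y := by ext; simp [LinearMap.restrict_apply]
  map_smul' x y := by ext; simp [LinearMap.restrict_apply]

@[simp] theorem rres_apply (W : Submodule ℂ V) (hW : Stb ρ W) (y : L) (w : W) :
    ((rres ρ W hW y w : W) : V) = ρ y w := rfl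

theorem rres_pow (W : Submodule ℂ V) (hW : Stb ρ W) (y : L) (w : W) (n : ℕ) :
    ((((rres ρ W hW y) ^ n) w : W) : V) = ((ρ y) ^ n) w := by
  induction n with
  | zero => simp
  | succ n ih => rw [pow_succ', pow_succ', Module.End.mul_apply, Module.End.mul_apply, rres_apply, ih]

theorem IsRep.rres (hρ : IsRep ρ) (W : Submodule ℂ V) (hW : Stb ρ W) : IsRep (rres ρ W hW) := by
  intro x y v
  ext
  simp [hρ x y v]

theorem rres_wt (W : Submodule ℂ V) (hW : Stb ρ W) (l : Module.Dual ℂ H) (w : W) :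
    w ∈ rwt H (rres ρ W hW) l ↔ (w : V) ∈ rwt H ρ l := by
  rw [mem_rwt, mem_rwt]
  refine forall_congr' fun h => ?_
  rw [Subtype.ext_iff]; simp

theorem IsWt.rres (h : IsWt H ρ) (W : Submodule ℂ V) (hW : Stb ρ W) : IsWt H (rres ρ W hW) := by
  constructor
  · rw [eq_top_iff]
    rintro ⟨w, hw⟩ _
    obtain ⟨s, f, hf, e⟩ := exists_decomp h.1 w
    have := comp_mem W (fun h w hw => hW h w hw) s f (fun l _ => hf l) (e ▸ hw)
    have e2 : (⟨w, hw⟩ : W) = ∑ l ∈ s.attach, ⟨f l, this l l.2⟩ := by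
      ext
      rw [AddSubmonoidClass.coe_finsetSum]
      exact e.trans (Finset.sum_attach s f).symm
    rw [e2]
    refine sum_mem fun l _ => Submodule.mem_iSup_of_mem (l : Module.Dual ℂ H) ?_
    rw [rres_wt]; exact hf _
  · intro l
    have := h.2 l
    let g : rwt H (Paper.rres ρ W hW) l →ₗ[ℂ] rwt H ρ l :=
      { toFun := fun w => ⟨w.1.1, (rres_wt W hW l w.1).1 w.2⟩
        map_add' := fun _ _ => rfl
        map_smul' := fun _ _ => rfl }
    exact FiniteDimensional.of_injective g fun a b hab => by
      ext; exact congrArg (fun z : rwt H ρ l => (z : V)) hab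

/-- quotient representation -/
def rquo (ρ : L →ₗ[ℂ] Module.End ℂ V) (W : Submodule ℂ V) (hW : Stb ρ W) :
    L →ₗ[ℂ] Module.End ℂ (V ⧸ W) where
  toFun y := W.mapQ W (ρ y) (hW y)
  map_add' x y := by ext; simp
  map_smul' x y := by ext; simp

@[simp] theorem rquo_apply (W : Submodule ℂ V) (hW : Stb ρ W) (y : L) (v : V) :
    rquo ρ W hW y (W.mkQ v) = W.mkQ (ρ y v) := rfl

theorem IsRep.rquo (hρ : IsRep ρ) (W : Submodule ℂ V) (hW : Stb ρ W) : IsRep (rquo ρ W hW) := by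
  intro x y v
  obtain ⟨v, rfl⟩ := W.mkQ_surjective v
  simp only [rquo_apply, hρ x y v, map_sub]

theorem IsWt.rquo (h : IsWt H ρ) (W : Submodule ℂ V) (hW : Stb ρ W) : IsWt H (rquo ρ W hW) := by
  classical
  have h1 : ∀ l, (rwt H ρ l).map W.mkQ ≤ rwt H (Paper.rquo ρ W hW) l := by
    rintro l _ ⟨v, hv, rfl⟩ h
    rw [rquo_apply, hv h, map_smul]
  have h2 : ∀ l, rwt H (Paper.rquo ρ W hW) l ≤ (rwt H ρ l).map W.mkQ := by
    intro l v hv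
    obtain ⟨v, rfl⟩ := W.mkQ_surjective v
    obtain ⟨s, f, hf, e⟩ := exists_decomp h.1 v
    have h3 : ∀ m ∈ s, m ≠ l → f m ∈ W := by
      intro m hm hne
      obtain ⟨h, hh⟩ : ∃ h, m h ≠ l h := by
        by_contra! hcon; exact hne (LinearMap.ext hcon)
      have h4 : ρ h v - l h • v ∈ W := by
        have := hv h
        rw [rquo_apply, ← map_smul, ← sub_eq_zero, ← map_sub] at this
        exact (Submodule.Quotient.mk_eq_zero W).1 this
      have := comp_mem W (fun h w hw => hW h w hw) s (fun m => (m h - l h) • f m)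
        (fun m _ => Submodule.smul_mem _ _ (hf m)) (by
          convert h4 using 1
          rw [e, map_sum, Finset.smul_sum, ← Finset.sum_sub_distrib]
          refine Finset.sum_congr rfl fun m _ => ?_
          rw [hf m h, sub_smul]) m hm
      exact (W.smul_mem_iff (sub_ne_zero.2 hh)).1 this
    by_cases hl : l ∈ s
    · refine ⟨f l, hf l, ?_⟩
      rw [e, map_sum, Finset.sum_eq_single l]
      · intro m hm hne; simpa using h3 m hm hne
      · intro h; exact absurd hl h
    · have : W.mkQ v = 0 := by
        rw [e, map_sum]
        refine Finset.sum_eq_zero fun m hm => ?_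
        have := h3 m hm (by rintro rfl; exact hl hm)
        simpa using this
      rw [this]; exact zero_mem _
  constructor
  · rw [eq_top_iff]
    intro v _
    obtain ⟨v, rfl⟩ := W.mkQ_surjective v
    obtain ⟨s, f, hf, e⟩ := exists_decomp h.1 v
    rw [e, map_sum]
    exact sum_mem fun l _ => Submodule.mem_iSup_of_mem l (h1 l ⟨_, hf l, rfl⟩)
  · intro l
    have := h.2 l
    rw [le_antisymm (h2 l) (h1 l)]
    infer_instance

/-- saturation with respect to an ad-nilpotent element -/
theorem sat_stable_aux (hρ : IsRep ρ) {T : Submodule ℂ V} (hT : Stb ρ T) (e : L) :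
    ∀ s k n : ℕ, k + n = s → ∀ y v, ((LieAlgebra.ad ℂ L e) ^ k) y = 0 → ((ρ e) ^ n) v ∈ T →
      ((ρ e) ^ s) (ρ y v) ∈ T := by
  have hTe : ∀ (j : ℕ) (v : V), v ∈ T → ((ρ e) ^ j) v ∈ T := by
    intro j
    induction j with
    | zero => intro v hv; simpa using hv
    | succ j ih => intro v hv; rw [pow_succ']; exact hT _ _ (ih v hv)
  intro s
  induction s with
  | zero =>
    intro k n hkn y v hy hv
    obtain ⟨rfl, rfl⟩ : k = 0 ∧ n = 0 := by omega
    simp at hy hv ⊢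
    exact hT _ _ hv
  | succ s ih =>
    intro k n hkn y v hy hv
    rcases Nat.eq_zero_or_pos k with rfl | hk
    · have : y = 0 := by simpa using hy
      rw [this]; simp
    rcases Nat.eq_zero_or_pos n with rfl | hn
    · exact hTe _ _ (hT _ _ (by simpa using hv))
    obtain ⟨k, rfl⟩ : ∃ k', k = k' + 1 := ⟨k - 1, by omega⟩
    obtain ⟨n, rfl⟩ : ∃ n', n = n' + 1 := ⟨n - 1, by omega⟩
    have e1 : ρ e (ρ y v) = ρ ⁅e, y⁆ v + ρ y (ρ e v) := by rw [hρ e y v]; abel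
    rw [pow_succ, Module.End.mul_apply, e1, map_add]
    refine add_mem (ih k (n + 1) (by omega) _ _ ?_ hv) (ih (k + 1) n (by omega) _ _ hy ?_)
    · rw [pow_succ, Module.End.mul_apply] at hy; simpa using hy
    · rwa [pow_succ, Module.End.mul_apply] at hv

def rsat (ρ : L →ₗ[ℂ] Module.End ℂ V) (T : Submodule ℂ V) (hT : Stb ρ T) (e : L) :
    Submodule ℂ V where
  carrier := {v | ∃ n : ℕ, ((ρ e) ^ n) v ∈ T}
  zero_mem' := ⟨0, by simp⟩
  smul_mem' := by rintro c v ⟨n, hn⟩; exact ⟨n, by rw [map_smul]; exact T.smul_mem _ hn⟩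
  add_mem' := by
    have hTe : ∀ (j : ℕ) (v : V), v ∈ T → ((ρ e) ^ j) v ∈ T := by
      intro j
      induction j with
      | zero => intro v hv; simpa using hv
      | succ j ih => intro v hv; rw [pow_succ']; exact hT _ _ (ih v hv)
    rintro v w ⟨n, hn⟩ ⟨m, hm⟩
    refine ⟨n + m, ?_⟩
    rw [map_add]
    refine add_mem ?_ ?_
    · rw [add_comm, pow_add]; exact hTe _ _ hn
    · rw [pow_add]; exact hTe _ _ hm

theorem mem_rsat {T : Submodule ℂ V} {hT : Stb ρ T} {e : L} {v : V} :
    v ∈ rsat ρ T hT e ↔ ∃ n : ℕ, ((ρ e) ^ n) v ∈ T := Iff.rfl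

theorem rsat_stb (hρ : IsRep ρ) {T : Submodule ℂ V} (hT : Stb ρ T) (e : L)
    (he : ∃ N, ∀ y, ((LieAlgebra.ad ℂ L e) ^ N) y = 0) : Stb ρ (rsat ρ T hT e) := by
  rintro y v ⟨n, hn⟩
  obtain ⟨N, hN⟩ := he
  exact ⟨N + n, sat_stable_aux hρ hT e _ N n rfl y v (hN y) hn⟩

theorem stb_bot : Stb ρ ⊥ := by
  intro y w hw
  rw [Submodule.mem_bot] at hw ⊢; rw [hw, map_zero]

theorem map_rwt (hρ : IsRep ρ) {l a : Module.Dual ℂ H} {x : L}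
    (hx : ∀ h : H, ⁅(h : L), x⁆ = a h • x) {v : V} (hv : v ∈ rwt H ρ l) :
    ρ x v ∈ rwt H ρ (l + a) := by
  intro h
  have := hρ h x v
  rw [hx h, map_smul, hv h, map_smul, LinearMap.smul_apply] at this
  rw [LinearMap.add_apply, add_smul, this]; abel

theorem map_rwt_pow (hρ : IsRep ρ) {a : Module.Dual ℂ H} {x : L}
    (hx : ∀ h : H, ⁅(h : L), x⁆ = a h • x) (n : ℕ) : ∀ {l : Module.Dual ℂ H}, ∀ {v : V},
    v ∈ rwt H ρ l → ((ρ x) ^ n) v ∈ rwt H ρ (l + n • a) := by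
  induction n with
  | zero => intro l v hv; simpa using hv
  | succ n ih =>
    intro l v hv
    rw [pow_succ', succ_nsmul, ← add_assoc]
    exact map_rwt hρ hx (ih hv)

/-- the support vanishes eventually in direction `a` -/
def Evt (H : LieSubalgebra ℂ L) (ρ : L →ₗ[ℂ] Module.End ℂ V) (a : Module.Dual ℂ H) : Prop :=
  ∀ l, ∃ N : ℕ, ∀ n ≥ N, rwt H ρ (l + n • a) = ⊥

theorem Evt.nilp (hwt : (⨆ l, rwt H ρ l) = ⊤) (hρ : IsRep ρ) {a : Module.Dual ℂ H} {x : L}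
    (hx : ∀ h : H, ⁅(h : L), x⁆ = a h • x) (ha : Evt H ρ a) (v : V) :
    ∃ n : ℕ, ((ρ x) ^ n) v = 0 := by
  have : v ∈ ⨆ l, rwt H ρ l := by rw [hwt]; trivial
  have h2 : (⨆ l, rwt H ρ l) ≤ rsat ρ ⊥ stb_bot x := by
    refine iSup_le fun l v hv => ?_
    obtain ⟨N, hN⟩ := ha l
    refine ⟨N, ?_⟩
    rw [← hN N le_rfl]
    exact map_rwt_pow hρ hx N hv
  obtain ⟨n, hn⟩ := h2 this
  exact ⟨n, by simpa using hn⟩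

theorem Evt.rres {a : Module.Dual ℂ H} (ha : Evt H ρ a) (W : Submodule ℂ V) (hW : Stb ρ W) :
    Evt H (rres ρ W hW) a := by
  intro l
  obtain ⟨N, hN⟩ := ha l
  refine ⟨N, fun n hn => ?_⟩
  rw [eq_bot_iff]
  intro w hw
  rw [rres_wt, hN n hn] at hw
  simpa using hw

theorem sl2_ef {E F K : Module.End ℂ V} {μ : ℂ} {v : V} (hEF : ∀ v, E (F v) = F (E v) + K v)
    (hK : ∀ n : ℕ, K ((F ^ n) v) = (μ - 2 * n) • (F ^ n) v) (hE : E v = 0) (n : ℕ) :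
    E ((F ^ (n + 1)) v) = ((n + 1 : ℂ) * (μ - n)) • (F ^ n) v := by
  induction n with
  | zero =>
    have := hK 0
    simp at this ⊢
    rw [hEF, hE, this]; simp
  | succ n ih =>
    rw [pow_succ', Module.End.mul_apply, hEF, ih, hK, map_smul, ← Module.End.mul_apply,
      ← pow_succ', ← add_smul]
    congr 1
    push_cast; ring

theorem sl2_ef_pow {E F K : Module.End ℂ V} {μ : ℂ} {v : V} (hEF : ∀ v, E (F v) = F (E v) + K v)
    (hK : ∀ n : ℕ, K ((F ^ n) v) = (μ - 2 * n) • (F ^ n) v) (hE : E v = 0) (hv : v ≠ 0) (k : ℕ)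
    (hμ : ∀ n < k, μ - n ≠ 0) : (E ^ k) ((F ^ k) v) ≠ 0 := by
  induction k with
  | zero => simpa using hv
  | succ k ih =>
    rw [pow_succ E, Module.End.mul_apply, sl2_ef hEF hK hE, map_smul]
    refine smul_ne_zero (mul_ne_zero ?_ (hμ k (by omega))) (ih fun n hn => hμ n (by omega))
    exact_mod_cast Nat.succ_ne_zero k

theorem lemmaB (hρ : IsRep ρ) (hwt : IsWt H ρ) {a : Module.Dual ℂ H} {e f : L} {h : H}
    (he : ∀ h : H, ⁅(h : L), e⁆ = a h • e) (hf : ∀ h : H, ⁅(h : L), f⁆ = (-a) h • f)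
    (hef : ⁅e, f⁆ = h) (ha : a h = 2) (hnil : ∀ v, ∃ n : ℕ, ((ρ e) ^ n) v = 0) : Evt H ρ a := by
  intro l
  have := hwt.2 l
  obtain ⟨k0, hk0⟩ : ∃ k0 : ℕ, ∀ v ∈ rwt H ρ l, ∀ k ≥ k0, ((ρ e) ^ k) v = 0 := by
    obtain ⟨s, hs⟩ := Submodule.fg_iff_finiteDimensional (rwt H ρ l) |>.2 this
    choose N hN using hnil
    refine ⟨s.sup N, fun v hv k hk => ?_⟩
    have : Submodule.span ℂ (s : Set V) ≤ LinearMap.ker ((ρ e) ^ k) := by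
      rw [Submodule.span_le]
      intro w hw
      have : N w ≤ k := le_trans (Finset.le_sup (f := N) hw) hk
      rw [SetLike.mem_coe, LinearMap.mem_ker]
      obtain ⟨j, rfl⟩ := Nat.exists_eq_add_of_le this
      rw [add_comm, pow_add, Module.End.mul_apply, hN, map_zero]
    rw [hs] at this
    exact this hv
  obtain ⟨N1, hN1⟩ := exists_nat_gt ‖l h‖
  refine ⟨max k0 N1, fun n hn => ?_⟩
  by_contra hne
  obtain ⟨v, hv, hv0⟩ := Submodule.exists_mem_ne_zero_of_ne_bot hne
  classical
  have hex := hnil v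
  set j := Nat.find hex with hj
  have hj1 := Nat.find_spec hex
  have hjpos : j ≠ 0 := by
    intro h0
    rw [← hj, h0] at hj1
    exact hv0 (by simpa using hj1)
  obtain ⟨i, hi⟩ := Nat.exists_eq_succ_of_ne_zero hjpos
  set w := ((ρ e) ^ i) v with hw
  have hw0 : w ≠ 0 := Nat.find_min hex (by omega)
  have hew : ρ e w = 0 := by
    rw [← hj, hi, Nat.succ_eq_add_one, pow_succ'] at hj1; exact hj1
  have hww : w ∈ rwt H ρ (l + (n + i) • a) := by
    rw [add_nsmul, ← add_assoc]; exact map_rwt_pow hρ he i hv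
  set k := n + i with hk
  have hFw : ∀ m : ℕ, ((ρ f) ^ m) w ∈ rwt H ρ (l + k • a + m • (-a)) := fun m =>
    map_rwt_pow hρ hf m hww
  have := sl2_ef_pow (E := ρ e) (F := ρ f) (K := ρ h) (μ := l h + 2 * k) (v := w)
    (fun v => by rw [← hef, hρ]; abel) (fun m => by
      rw [hFw m h]; congr 1; simp [ha]; ring) hew hw0 k (fun m hm h0 => by
      have h1 : l h = (m : ℂ) - 2 * k := by linear_combination h0
      have h2 : (k : ℝ) ≤ ‖l h‖ := by
        have h3 : (l h) = ((m - 2 * k : ℝ) : ℂ) := by rw [h1]; push_cast; ring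
        rw [h3, Complex.norm_real, Real.norm_eq_abs]
        have : (m : ℝ) < k := by exact_mod_cast hm
        rw [abs_of_neg (by linarith)]; linarith
      have h4 : (N1 : ℝ) ≤ k := by
        have : N1 ≤ k := by omega
        exact_mod_cast this
      linarith)
  apply this
  refine hk0 _ ?_ k (by omega)
  have h5 := hFw k
  rwa [smul_neg, add_neg_cancel_right] at h5

/-- submodule generated -/
def rgen (ρ : L →ₗ[ℂ] Module.End ℂ V) (s : Set V) : Submodule ℂ V :=
  sInf {W | Stb ρ W ∧ s ⊆ W}

theorem rgen_stb (s : Set V) : Stb ρ (rgen ρ s) := by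
  intro y w hw
  simp only [rgen, Submodule.mem_sInf, Set.mem_ofPred_eq] at hw ⊢
  exact fun W hW => hW.1 y w (hw W hW)

theorem subset_rgen (s : Set V) : s ⊆ rgen ρ s := by
  intro w hw
  simp only [rgen, SetLike.mem_coe, Submodule.mem_sInf, Set.mem_ofPred_eq]
  exact fun W hW => hW.2 hw

theorem rgen_le {s : Set V} {W : Submodule ℂ V} (hW : Stb ρ W) (h : s ⊆ W) : rgen ρ s ≤ W :=
  sInf_le ⟨hW, h⟩

def IsMinS (ρ : L →ₗ[ℂ] Module.End ℂ V) (T : Submodule ℂ V) : Prop :=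
  Stb ρ T ∧ T ≠ ⊥ ∧ ∀ W ≤ T, Stb ρ W → W ≠ ⊥ → T ≤ W

theorem IsMinS.of_rres {W : Submodule ℂ V} {hW : Stb ρ W} {T : Submodule ℂ W}
    (hT : IsMinS (rres ρ W hW) T) : IsMinS ρ (T.map W.subtype) := by
  refine ⟨?_, ?_, ?_⟩
  · rintro y _ ⟨w, hw, rfl⟩
    exact ⟨_, hT.1 y w hw, rfl⟩
  · intro h
    apply hT.2.1
    rw [eq_bot_iff]
    intro w hw
    have : W.subtype w ∈ (⊥ : Submodule ℂ V) := h ▸ ⟨w, hw, rfl⟩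
    simpa using this
  · intro X hX hXs hX0
    have h1 : Stb (rres ρ W hW) (X.comap W.subtype) := fun y w hw => hXs y _ hw
    have h2 : (X.comap W.subtype).map W.subtype = X := by
      rw [Submodule.map_comap_subtype, inf_eq_right]
      exact hX.trans (Submodule.map_subtype_le _ _)
    have h3 : X.comap W.subtype ≤ T := by
      intro w hw
      obtain ⟨w', hw', e⟩ := hX hw
      have : w' = w := Subtype.ext e
      exact this ▸ hw'
    have := hT.2.2 _ h3 h1 (by intro h; apply hX0; rw [← h2, h, Submodule.map_bot])
    rw [← h2]
    exact Submodule.map_mono this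

/-- injectivity both ways implies bijectivity -/
theorem surj_of_inj (hρ : IsRep ρ) (hwt : IsWt H ρ) {a : Module.Dual ℂ H} {e f : L}
    (he : ∀ h : H, ⁅(h : L), e⁆ = a h • e) (hf : ∀ h : H, ⁅(h : L), f⁆ = (-a) h • f)
    (hei : Function.Injective (ρ e)) (hfi : Function.Injective (ρ f)) :
    Function.Surjective (ρ e) := by
  rw [← LinearMap.range_eq_top, eq_top_iff, ← hwt.1]
  refine iSup_le fun l => ?_
  have h1 := hwt.2 l
  have h2 := hwt.2 (l - a)
  let E : rwt H ρ (l - a) →ₗ[ℂ] rwt H ρ l :=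
    (ρ e).restrict (fun v hv => by have := map_rwt hρ he hv; rwa [sub_add_cancel] at this)
  let F : rwt H ρ l →ₗ[ℂ] rwt H ρ (l - a) :=
    (ρ f).restrict (fun v hv => by have := map_rwt hρ hf hv; rwa [← sub_eq_add_neg] at this)
  have hE : Function.Injective E := fun x y h => Subtype.ext (hei (congrArg Subtype.val h))
  have hF : Function.Injective F := fun x y h => Subtype.ext (hfi (congrArg Subtype.val h))
  have hr := le_antisymm (LinearMap.finrank_le_finrank_of_injective hE)
    (LinearMap.finrank_le_finrank_of_injective hF)
  have hs := (LinearMap.injective_iff_surjective_of_finrank_eq_finrank hr).1 hE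
  intro v hv
  obtain ⟨w, hw⟩ := hs ⟨v, hv⟩
  exact ⟨w, congrArg Subtype.val hw⟩

end WM

section Twist
open Polynomial

/-- vector valued polynomial functions -/
def PF (V : Type*) [AddCommGroup V] [Module ℂ V] : Submodule ℂ (ℂ → V) :=
  Submodule.span ℂ {f | ∃ (p : ℂ[X]) (v : V), f = fun x => p.eval x • v}

variable {V : Type*} [AddCommGroup V] [Module ℂ V]

theorem PF_basic (p : ℂ[X]) (v : V) : (fun x => p.eval x • v) ∈ PF V :=
  Submodule.subset_span ⟨p, v, rfl⟩

theorem PF_const (v : V) : (fun _ => v) ∈ PF V := by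
  simpa using PF_basic (1 : ℂ[X]) v

theorem PF_smul {f : ℂ → V} (hf : f ∈ PF V) (p : ℂ[X]) : (fun x => p.eval x • f x) ∈ PF V := by
  induction hf using Submodule.span_induction with
  | mem f hf =>
    obtain ⟨q, v, rfl⟩ := hf
    simpa [smul_smul] using PF_basic (p * q) v
  | zero => simpa using PF_const (0 : V)
  | add f g _ _ hf hg =>
    have := (PF V).add_mem hf hg
    convert this using 1
    ext x; simp
  | smul c f _ hf =>
    have := (PF V).smul_mem c hf
    convert this using 1
    ext x; simp [smul_smul, mul_comm]

theorem PF_map {W : Type*} [AddCommGroup W] [Module ℂ W] {f : ℂ → V} (hf : f ∈ PF V)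
    (g : V →ₗ[ℂ] W) : (fun x => g (f x)) ∈ PF W := by
  induction hf using Submodule.span_induction with
  | mem f hf =>
    obtain ⟨q, v, rfl⟩ := hf
    simpa using PF_basic q (g v)
  | zero => simpa using PF_const (0 : W)
  | add f g _ _ hf hg =>
    have := (PF W).add_mem hf hg
    convert this using 1
    ext x; simp
  | smul c f _ hf =>
    have := (PF W).smul_mem c hf
    convert this using 1
    ext x; simp

theorem PF_sum {ι : Type*} (s : Finset ι) (f : ι → ℂ → V) (hf : ∀ i ∈ s, f i ∈ PF V) :
    (fun x => ∑ i ∈ s, f i x) ∈ PF V := by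
  have := (PF V).sum_mem hf
  convert this using 1
  ext x; simp

theorem PF_sub {f g : ℂ → V} (hf : f ∈ PF V) (hg : g ∈ PF V) : (fun x => f x - g x) ∈ PF V :=
  (PF V).sub_mem hf hg

theorem PF_scalar {f : ℂ → ℂ} (hf : f ∈ PF ℂ) : ∃ p : ℂ[X], ∀ x, f x = p.eval x := by
  induction hf using Submodule.span_induction with
  | mem f hf =>
    obtain ⟨q, v, rfl⟩ := hf
    exact ⟨q * C v, by simp⟩
  | zero => exact ⟨0, by simp⟩
  | add f g _ _ hf hg =>
    obtain ⟨p, hp⟩ := hf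
    obtain ⟨q, hq⟩ := hg
    exact ⟨p + q, by simp [hp, hq]⟩
  | smul c f _ hf =>
    obtain ⟨p, hp⟩ := hf
    exact ⟨C c * p, by simp [hp]⟩

theorem PF_mem {f : ℂ → V} (hf : f ∈ PF V) (K : Submodule ℂ V) (x : ℂ)
    (h : ∀ n : ℕ, f (x + n) ∈ K) (y : ℂ) : f y ∈ K := by
  rw [← Submodule.Quotient.mk_eq_zero, ← Module.forall_dual_apply_eq_zero_iff ℂ]
  intro φ
  obtain ⟨p, hp⟩ := PF_scalar (PF_map hf (φ.comp K.mkQ))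
  have hp0 : p = 0 := by
    apply Polynomial.eq_zero_of_infinite_isRoot
    refine Set.Infinite.mono (s := Set.range fun n : ℕ => x + (n : ℂ)) ?_
      (Set.infinite_range_of_injective fun a b hab => by simpa using hab)
    rintro _ ⟨n, rfl⟩
    show p.eval _ = 0
    rw [← hp]
    have : K.mkQ (f (x + n)) = 0 := (Submodule.Quotient.mk_eq_zero K).2 (h n)
    rw [LinearMap.comp_apply, this, map_zero]
  have := hp y
  rw [hp0] at this
  simpa using this

theorem PF_zero {f : ℂ → V} (hf : f ∈ PF V) (h : ∀ n : ℕ, f n = 0) (y : ℂ) : f y = 0 := by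
  have := PF_mem hf ⊥ 0 (fun n => by simp [h n]) y
  simpa using this

/-- binomial polynomials -/
noncomputable def bp (i : ℕ) : ℂ[X] := C ((i.factorial : ℂ)⁻¹) * descPochhammer ℂ i

theorem bp_nat (i n : ℕ) : (bp i).eval (n : ℂ) = (n.choose i : ℂ) := by
  rw [bp, eval_mul, eval_C, descPochhammer_eval_eq_descFactorial,
    Nat.descFactorial_eq_factorial_mul_choose]
  push_cast
  rw [← mul_assoc, inv_mul_cancel₀ (by exact_mod_cast Nat.factorial_ne_zero i), one_mul]

theorem bp_zero (x : ℂ) : (bp 0).eval x = 1 := by simp [bp]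
theorem bp_one (x : ℂ) : (bp 1).eval x = x := by simp [bp]
theorem bp_two (x : ℂ) : (bp 2).eval x = x * (x - 1) / 2 := by
  simp [bp, descPochhammer_succ_right, Nat.factorial]; ring

variable {L : Type*} [LieRing L] [LieAlgebra ℂ L] {ρ : L →ₗ[ℂ] Module.End ℂ V}

/-- twisted representation -/
noncomputable def tw (ρ : L →ₗ[ℂ] Module.End ℂ V) (e : L) (E' : Module.End ℂ V) (N : ℕ) (x : ℂ) :
    L →ₗ[ℂ] Module.End ℂ V :=
  ∑ i ∈ Finset.range N, (bp i).eval x •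
    ((LinearMap.mulRight ℂ (E' ^ i)) ∘ₗ ρ ∘ₗ ((LieAlgebra.ad ℂ L e) ^ i))

theorem tw_apply (e : L) (E' : Module.End ℂ V) (N : ℕ) (x : ℂ) (y : L) (v : V) :
    tw ρ e E' N x y v = ∑ i ∈ Finset.range N, (bp i).eval x •
      ρ (((LieAlgebra.ad ℂ L e) ^ i) y) ((E' ^ i) v) := by
  simp [tw, LinearMap.sum_apply]

theorem tw_nat (hρ : IsRep ρ) {e : L} {E' : Module.End ℂ V} (h1 : ρ e * E' = 1) (h2 : E' * ρ e = 1)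
    {N : ℕ} (hN : ∀ y, ((LieAlgebra.ad ℂ L e) ^ N) y = 0) (n : ℕ) (y : L) :
    tw ρ e E' N n y = (ρ e) ^ n * ρ y * E' ^ n := by
  set E := ρ e with hE
  have hc : Commute E E' := by rw [Commute, SemiconjBy, h1, h2]
  let T : Module.End ℂ (Module.End ℂ V) :=
    LinearMap.mulRight ℂ E' * (LinearMap.mulLeft ℂ E - LinearMap.mulRight ℂ E)
  have hT : ∀ a, T a = (E * a - a * E) * E' := fun a => by simp [T]
  have hTi : ∀ i : ℕ, (T ^ i) (ρ y) = ρ (((LieAlgebra.ad ℂ L e) ^ i) y) * E' ^ i := by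
    intro i
    induction i with
    | zero => simp
    | succ i ih =>
      rw [pow_succ', Module.End.mul_apply, ih, hT, pow_succ' (LieAlgebra.ad ℂ L e),
        Module.End.mul_apply]
      set z := ((LieAlgebra.ad ℂ L e) ^ i) y
      have : ρ (LieAlgebra.ad ℂ L e z) = E * ρ z - ρ z * E := by
        ext v; simp [hρ e z v, hE]
      rw [this, mul_assoc (ρ z), ((hc.symm.pow_left i).eq), pow_succ]
      noncomm_ring
  have hconj : ∀ n : ℕ, ((T + 1) ^ n) (ρ y) = E ^ n * ρ y * E' ^ n := by
    intro n
    induction n with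
    | zero => simp
    | succ n ih =>
      rw [pow_succ', Module.End.mul_apply, ih]
      have : ∀ a, (T + 1) a = E * a * E' := fun a => by
        rw [LinearMap.add_apply, hT, Module.End.one_apply, sub_mul, mul_assoc a, h1, mul_one,
          sub_add_cancel]
      rw [this, pow_succ' E, pow_succ E']
      noncomm_ring
  have hD : ∀ i, N ≤ i → ((LieAlgebra.ad ℂ L e) ^ i) y = 0 := by
    intro i hi
    obtain ⟨j, rfl⟩ := Nat.exists_eq_add_of_le hi
    rw [pow_add, Module.End.mul_apply, hN]
  rw [← hconj, (Commute.one_right T).add_pow]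
  have e1 : tw ρ e E' N n y = ∑ i ∈ Finset.range N, (n.choose i : ℂ) • (T ^ i) (ρ y) := by
    ext v
    rw [tw_apply]
    simp [hTi, bp_nat, LinearMap.sum_apply]
  have e2 : (∑ m ∈ Finset.range (n + 1), T ^ m * 1 ^ (n - m) * (n.choose m : Module.End ℂ (Module.End ℂ V))) (ρ y)
      = ∑ i ∈ Finset.range (n + 1), (n.choose i : ℂ) • (T ^ i) (ρ y) := by
    rw [LinearMap.sum_apply]
    refine Finset.sum_congr rfl fun i _ => ?_
    rw [one_pow, mul_one, ← Nat.cast_comm, ← nsmul_eq_mul, LinearMap.smul_apply, Nat.cast_smul_eq_nsmul]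
  rw [e1, e2]
  have s1 : ∑ i ∈ Finset.range N, (n.choose i : ℂ) • (T ^ i) (ρ y)
      = ∑ i ∈ Finset.range (max N (n + 1)), (n.choose i : ℂ) • (T ^ i) (ρ y) := by
    refine Finset.sum_subset (by simp) fun i _ hi => ?_
    rw [hTi, hD i (by simpa using hi), map_zero, zero_mul, smul_zero]
  have s2 : ∑ i ∈ Finset.range (n + 1), (n.choose i : ℂ) • (T ^ i) (ρ y)
      = ∑ i ∈ Finset.range (max N (n + 1)), (n.choose i : ℂ) • (T ^ i) (ρ y) := by
    refine Finset.sum_subset (by simp) fun i _ hi => ?_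
    rw [Nat.choose_eq_zero_of_lt (by simp at hi; omega)]; simp
  rw [s1, s2]

theorem tw_PF (e : L) (E' : Module.End ℂ V) (N : ℕ) (y : L) {f : ℂ → V} (hf : f ∈ PF V) :
    (fun x => tw ρ e E' N x y (f x)) ∈ PF V := by
  simp only [tw_apply]
  refine PF_sum _ _ fun i _ => PF_smul (PF_map (PF_map hf (E' ^ i)) _) _

theorem pow_cancel {E E' : Module.End ℂ V} (h : E' * E = 1) (n : ℕ) (v : V) :
    (E' ^ n) ((E ^ n) v) = v := by
  induction n with
  | zero => simp
  | succ n ih =>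
    rw [pow_succ, pow_succ' E, Module.End.mul_apply, Module.End.mul_apply,
      ← Module.End.mul_apply E', h, Module.End.one_apply, ih]

theorem tw_isRep (hρ : IsRep ρ) {e : L} {E' : Module.End ℂ V} (h1 : ρ e * E' = 1)
    (h2 : E' * ρ e = 1) {N : ℕ} (hN : ∀ y, ((LieAlgebra.ad ℂ L e) ^ N) y = 0) (x : ℂ) :
    IsRep (tw ρ e E' N x) := by
  intro y z v
  rw [← sub_eq_zero]
  refine PF_zero (f := fun x => tw ρ e E' N x ⁅y, z⁆ v - (tw ρ e E' N x y (tw ρ e E' N x z v)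
    - tw ρ e E' N x z (tw ρ e E' N x y v))) ?_ ?_ x
  · exact PF_sub (tw_PF _ _ _ _ (PF_const v)) (PF_sub (tw_PF _ _ _ _ (tw_PF _ _ _ _ (PF_const v)))
      (tw_PF _ _ _ _ (tw_PF _ _ _ _ (PF_const v))))
  · intro n
    simp only [tw_nat hρ h1 h2 hN, Module.End.mul_apply, pow_cancel h2, hρ y z, map_sub, sub_self]

theorem tw_add (hρ : IsRep ρ) {e : L} {E' : Module.End ℂ V} (h1 : ρ e * E' = 1)
    (h2 : E' * ρ e = 1) {N : ℕ} (hN : ∀ y, ((LieAlgebra.ad ℂ L e) ^ N) y = 0) (x : ℂ) (n : ℕ)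
    (y : L) (v : V) :
    tw ρ e E' N (x + n) y v = ((ρ e) ^ n) (tw ρ e E' N x y ((E' ^ n) v)) := by
  rw [← sub_eq_zero]
  refine PF_zero (f := fun x => tw ρ e E' N (x + n) y v
    - ((ρ e) ^ n) (tw ρ e E' N x y ((E' ^ n) v))) ?_ ?_ x
  · refine PF_sub ?_ (PF_map (tw_PF _ _ _ _ (PF_const _)) _)
    simp only [tw_apply]
    refine PF_sum _ _ fun i _ => ?_
    have := PF_basic ((bp i).comp (X + C (n : ℂ))) (ρ (((LieAlgebra.ad ℂ L e) ^ i) y) ((E' ^ i) v))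
    simpa using this
  · intro m
    rw [← Nat.cast_add, tw_nat hρ h1 h2 hN, tw_nat hρ h1 h2 hN]
    simp only [Module.End.mul_apply]
    rw [← Module.End.mul_apply (ρ e ^ n), ← Module.End.mul_apply (E' ^ m), ← pow_add, ← pow_add,
      add_comm n m, sub_self]

theorem tw_zero {e : L} {E' : Module.End ℂ V} {N : ℕ} (hN : 0 < N) (y : L) (v : V) :
    tw ρ e E' N 0 y v = ρ y v := by
  rw [tw_apply, Finset.sum_eq_single_of_mem 0 (by simpa using hN)]
  · simp [bp_zero]
  · intro i _ hi
    have : (bp i).eval (0 : ℂ) = 0 := by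
      have := bp_nat i 0
      rw [Nat.cast_zero] at this
      rw [this, Nat.choose_eq_zero_of_lt (by omega)]; simp
    rw [this, zero_smul]

/-- evaluation on elements with short ad-strings -/
theorem tw_three {e : L} {E' : Module.End ℂ V} {N : ℕ} (hN : 3 ≤ N) (x : ℂ) (y : L) (v : V)
    (hy : ⁅e, ⁅e, ⁅e, y⁆⁆⁆ = 0) :
    tw ρ e E' N x y v = ρ y v + x • ρ ⁅e, y⁆ (E' v)
      + (x * (x - 1) / 2) • ρ ⁅e, ⁅e, y⁆⁆ (E' (E' v)) := by
  rw [tw_apply]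
  have : ∑ i ∈ Finset.range 3, (bp i).eval x •
      ρ (((LieAlgebra.ad ℂ L e) ^ i) y) ((E' ^ i) v) = ∑ i ∈ Finset.range N, (bp i).eval x •
      ρ (((LieAlgebra.ad ℂ L e) ^ i) y) ((E' ^ i) v) := by
    refine Finset.sum_subset (by simpa using hN) fun i _ hi => ?_
    obtain ⟨j, rfl⟩ := Nat.exists_eq_add_of_le (show 3 ≤ i by simpa using hi)
    have h3 : ((LieAlgebra.ad ℂ L e) ^ 3) y = 0 := by simpa [pow_succ] using hy
    rw [add_comm 3 j, pow_add, Module.End.mul_apply, h3]; simp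
  rw [← this]
  simp [Finset.sum_range_succ, bp_zero, bp_one, bp_two, pow_succ]

theorem tw_stb_of_stb {e : L} {E' : Module.End ℂ V} {N : ℕ} (x : ℂ) {W : Submodule ℂ V}
    (hW : Stb ρ W) (hE : ∀ w ∈ W, E' w ∈ W) : Stb (tw ρ e E' N x) W := by
  intro y w hw
  rw [tw_apply]
  refine sum_mem fun i hi => W.smul_mem _ (hW _ _ ?_)
  clear hi
  induction i with
  | zero => simpa using hw
  | succ i ih => rw [pow_succ']; exact hE _ ih

theorem stb_of_tw_stb (hρ : IsRep ρ) {e : L} {E' : Module.End ℂ V} (h1 : ρ e * E' = 1)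
    (h2 : E' * ρ e = 1) {N : ℕ} (hN0 : 0 < N) (hN : ∀ y, ((LieAlgebra.ad ℂ L e) ^ N) y = 0) (x : ℂ)
    {W : Submodule ℂ V} (hW : Stb (tw ρ e E' N x) W) (hE : ∀ w ∈ W, ρ e w ∈ W)
    (hE' : ∀ w ∈ W, E' w ∈ W) : Stb ρ W := by
  have p1 : ∀ (n : ℕ), ∀ w ∈ W, ((ρ e) ^ n) w ∈ W := by
    intro n w hw
    induction n with
    | zero => simpa using hw
    | succ i ih => rw [pow_succ']; exact hE _ ih
  have p2 : ∀ (n : ℕ), ∀ w ∈ W, (E' ^ n) w ∈ W := by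
    intro n w hw
    induction n with
    | zero => simpa using hw
    | succ i ih => rw [pow_succ']; exact hE' _ ih
  intro y w hw
  rw [← tw_zero (ρ := ρ) (e := e) (E' := E') hN0 y w]
  refine PF_mem (tw_PF e E' N y (PF_const w)) W x (fun n => ?_) 0
  rw [tw_add hρ h1 h2 hN]
  exact p1 _ _ (hW _ _ (p2 _ _ hw))

end Twist

section Root

variable {L : Type*} [LieRing L] [LieAlgebra ℂ L]

/-- root data -/
structure RD (H : LieSubalgebra ℂ L) where
  R : Finset (Module.Dual ℂ H)
  e : Module.Dual ℂ H → L
  f : Module.Dual ℂ H → L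
  t : Module.Dual ℂ H → H
  ne0 : ∀ a ∈ R, a ≠ 0
  neg : ∀ a ∈ R, -a ∈ R
  wt : ∀ a ∈ R, ∀ h : H, ⁅(h : L), e a⁆ = a h • e a
  fe : ∀ a ∈ R, ∃ c : ℂ, c ≠ 0 ∧ f a = c • e (-a)
  eft : ∀ a ∈ R, ⁅e a, f a⁆ = t a
  span : ∀ y : L, ∃ h : H, ∃ c : Module.Dual ℂ H → ℂ, y = h + ∑ a ∈ R, c a • e a
  brk : ∀ a ∈ R, ∀ b ∈ R, a + b ≠ 0 →
    (a + b ∈ R ∧ ∃ c : ℂ, ⁅e a, e b⁆ = c • e (a + b)) ∨ ⁅e a, e b⁆ = 0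
  adnil : ∀ a ∈ R, ∃ N, ∀ y, ((LieAlgebra.ad ℂ L (e a)) ^ N) y = 0
  cr : ∀ a ∈ R, ∃ c : ℝ, 0 < c ∧ a (t a) = 2 * c ∧ ∀ b ∈ R, ∃ n : ℤ, b (t a) = c * n
  tspan : Submodule.span ℂ (t '' R) = ⊤
  K : L →ₗ[ℂ] L →ₗ[ℂ] ℂ
  Ksymm : ∀ a b, K a b = K b a
  Kinv : ∀ y a b : L, K ⁅y, a⁆ b = - K a ⁅y, b⁆
  ex1 : ∀ y : L, y = ∑ a ∈ R, (K y (t a) • (t a : L) + K y (f a) • e a)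
  ex2 : ∀ y : L, y = ∑ a ∈ R, (K y (t a) • (t a : L) + K y (e a) • f a)

variable {H : LieSubalgebra ℂ L} (D : RD H) {V : Type*} [AddCommGroup V] [Module ℂ V]
  {ρ : L →ₗ[ℂ] Module.End ℂ V}

theorem RD.wtf (a : Module.Dual ℂ H) (ha : a ∈ D.R) (h : H) : ⁅(h : L), D.f a⁆ = (-a) h • D.f a := by
  obtain ⟨c, _, hc⟩ := D.fe a ha
  rw [hc, lie_smul, D.wt _ (D.neg a ha), smul_comm]

theorem RD.fnil (a : Module.Dual ℂ H) (ha : a ∈ D.R) :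
    ∃ N, ∀ y, ((LieAlgebra.ad ℂ L (D.f a)) ^ N) y = 0 := by
  obtain ⟨c, _, hc⟩ := D.fe a ha
  obtain ⟨N, hN⟩ := D.adnil _ (D.neg a ha)
  refine ⟨N, fun y => ?_⟩
  rw [hc, map_smul, smul_pow, LinearMap.smul_apply, hN, smul_zero]

theorem RD.stb_of {W : Submodule ℂ V} (h1 : ∀ h : H, ∀ w ∈ W, ρ h w ∈ W)
    (h2 : ∀ a ∈ D.R, ∀ w ∈ W, ρ (D.e a) w ∈ W) : Stb ρ W := by
  intro y w hw
  obtain ⟨h, c, rfl⟩ := D.span y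
  simp only [map_add, map_sum, map_smul, LinearMap.add_apply, LinearMap.sum_apply,
    LinearMap.smul_apply]
  exact add_mem (h1 h w hw) (sum_mem fun a ha => W.smul_mem _ (h2 a ha w hw))

theorem cas_generic {ι : Type*} (s : Finset ι) (a b : ι → L) (K : L →ₗ[ℂ] L →ₗ[ℂ] ℂ)
    (Ksymm : ∀ a b, K a b = K b a) (Kinv : ∀ y a b : L, K ⁅y, a⁆ b = - K a ⁅y, b⁆)
    (ex1 : ∀ y : L, y = ∑ i ∈ s, K y (b i) • a i) (ex2 : ∀ y : L, y = ∑ i ∈ s, K y (a i) • b i)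
    (hρ : IsRep ρ) (y : L) :
    ρ y * (∑ i ∈ s, ρ (a i) * ρ (b i)) = (∑ i ∈ s, ρ (a i) * ρ (b i)) * ρ y := by
  have hm : ∀ x y, ρ ⁅x, y⁆ = ρ x * ρ y - ρ y * ρ x := fun x y => by ext v; simp [hρ x y v]
  rw [← sub_eq_zero, Finset.mul_sum, Finset.sum_mul, ← Finset.sum_sub_distrib]
  have e1 : ∀ i ∈ s, ρ y * (ρ (a i) * ρ (b i)) - ρ (a i) * ρ (b i) * ρ y
      = ∑ j ∈ s, K ⁅y, a i⁆ (b j) • (ρ (a j) * ρ (b i))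
        + ∑ j ∈ s, K ⁅y, b i⁆ (a j) • (ρ (a i) * ρ (b j)) := by
    intro i _
    have h1 : ρ ⁅y, a i⁆ = ∑ j ∈ s, K ⁅y, a i⁆ (b j) • ρ (a j) := by
      conv_lhs => rw [ex1 ⁅y, a i⁆]
      simp
    have h2 : ρ ⁅y, b i⁆ = ∑ j ∈ s, K ⁅y, b i⁆ (a j) • ρ (b j) := by
      conv_lhs => rw [ex2 ⁅y, b i⁆]
      simp
    calc _ = ρ ⁅y, a i⁆ * ρ (b i) + ρ (a i) * ρ ⁅y, b i⁆ := by rw [hm, hm]; noncomm_ring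
      _ = _ := by
        rw [h1, h2, Finset.sum_mul, Finset.mul_sum]
        simp only [smul_mul_assoc, mul_smul_comm]
  rw [Finset.sum_congr rfl e1, Finset.sum_add_distrib]
  conv_lhs => enter [2]; rw [Finset.sum_comm]
  rw [← Finset.sum_add_distrib]
  refine Finset.sum_eq_zero fun i _ => ?_
  rw [← Finset.sum_add_distrib]
  refine Finset.sum_eq_zero fun j _ => ?_
  rw [← add_smul, Kinv, Ksymm, neg_add_cancel, zero_smul]

/-- Casimir operator -/
noncomputable def RD.cas (ρ : L →ₗ[ℂ] Module.End ℂ V) : Module.End ℂ V :=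
  ∑ a ∈ D.R, (ρ (D.t a) * ρ (D.t a) + ρ (D.e a) * ρ (D.f a))

theorem RD.cas_comm (hρ : IsRep ρ) (y : L) : ρ y * D.cas ρ = D.cas ρ * ρ y := by
  have := cas_generic (ρ := ρ) (D.R.disjSum D.R) (Sum.elim (fun a => (D.t a : L)) D.e)
    (Sum.elim (fun a => (D.t a : L)) D.f) D.K D.Ksymm D.Kinv
    (fun y => by rw [Finset.sum_disjSum]; simpa [Finset.sum_add_distrib] using D.ex1 y)
    (fun y => by rw [Finset.sum_disjSum]; simpa [Finset.sum_add_distrib] using D.ex2 y) hρ y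
  rw [Finset.sum_disjSum] at this
  simpa [RD.cas, Finset.sum_add_distrib] using this

/-- positive systems -/
structure RD.IsPS (Q : Finset (Module.Dual ℂ H)) : Prop where
  sub : Q ⊆ D.R
  cov : ∀ a ∈ D.R, a ∈ Q ∨ -a ∈ Q
  dis : ∀ a ∈ Q, -a ∉ Q

/-- highest weight vectors -/
def RD.IsHi (Q : Finset (Module.Dual ℂ H)) (ρ : L →ₗ[ℂ] Module.End ℂ V) (l : Module.Dual ℂ H)
    (v : V) : Prop := v ≠ 0 ∧ v ∈ rwt H ρ l ∧ ∀ a ∈ Q, ρ (D.e a) v = 0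

noncomputable def RD.q (Q : Finset (Module.Dual ℂ H)) (l : Module.Dual ℂ H) : ℂ :=
  ∑ a ∈ D.R, (l (D.t a)) ^ 2 + ∑ a ∈ Q, l (D.t a)

theorem RD.cas_hi (hρ : IsRep ρ) {Q : Finset (Module.Dual ℂ H)} (hQ : D.IsPS Q)
    {l : Module.Dual ℂ H} {v : V} (hv : D.IsHi Q ρ l v) : D.cas ρ v = D.q Q l • v := by
  classical
  have h1 : ∀ a ∈ D.R, ρ (D.e a) (ρ (D.f a) v) = if a ∈ Q then l (D.t a) • v else 0 := by
    intro a ha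
    split_ifs with haQ
    · have := hρ (D.e a) (D.f a) v
      rw [D.eft a ha, hv.2.2 a haQ, map_zero, sub_zero, hv.2.1] at this
      exact this.symm
    · obtain ⟨c, _, hc⟩ := D.fe a ha
      have : -a ∈ Q := (hQ.cov a ha).resolve_left haQ
      rw [hc, map_smul, LinearMap.smul_apply, hv.2.2 _ this, smul_zero, map_zero]
  have h2 : ∀ a ∈ D.R, ρ (D.t a) (ρ (D.t a) v) = (l (D.t a)) ^ 2 • v := by
    intro a _
    rw [hv.2.1, map_smul, hv.2.1, smul_smul, pow_two]
  rw [RD.cas, LinearMap.sum_apply, RD.q, add_smul, Finset.sum_smul, Finset.sum_smul]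
  simp only [LinearMap.add_apply, Module.End.mul_apply]
  rw [Finset.sum_add_distrib, Finset.sum_congr rfl h1, Finset.sum_congr rfl h2, ← Finset.sum_filter]
  congr 2
  ext a
  simp only [Finset.mem_filter]
  exact ⟨fun h => h.2, fun h => ⟨hQ.sub h, h⟩⟩

theorem fin_quad {ι : Type*} (s : Finset ι) (c b : ι → ℝ) (hc : ∀ i ∈ s, 0 < c i) :
    Set.Finite {y : s → ℤ | ∑ i : s, ((c i) ^ 2 * (y i : ℝ) ^ 2 + b i * y i) = 0} := by
  classical
  -- bound
  let B : ℝ := ∑ i : s, (b i) ^ 2 / (2 * (c i) ^ 2)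
  have key : ∀ y : s → ℤ, ∑ i : s, ((c i) ^ 2 * (y i : ℝ) ^ 2 + b i * y i) = 0 →
      ∀ i : s, (c i) ^ 2 / 2 * (y i : ℝ) ^ 2 ≤ B := by
    intro y hy i
    have h1 : ∀ j : s, (c j) ^ 2 / 2 * (y j : ℝ) ^ 2 ≤ ((c j) ^ 2 * (y j : ℝ) ^ 2 + b j * y j)
        + (b j) ^ 2 / (2 * (c j) ^ 2) := by
      intro j
      have hcj := hc j j.2
      have : ((c j) ^ 2 * (y j : ℝ) ^ 2 + b j * y j) + (b j) ^ 2 / (2 * (c j) ^ 2)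
        - (c j) ^ 2 / 2 * (y j : ℝ) ^ 2 = (c j * y j + b j / c j) ^ 2 / 2 := by
        field_simp; ring
      have h3 : 0 ≤ (c j * y j + b j / c j) ^ 2 / 2 := by positivity
      linarith
    calc (c i) ^ 2 / 2 * (y i : ℝ) ^ 2 ≤ ∑ j : s, (c j) ^ 2 / 2 * (y j : ℝ) ^ 2 :=
          Finset.single_le_sum (f := fun j : s => (c j) ^ 2 / 2 * (y j : ℝ) ^ 2)
            (fun j _ => by positivity) (Finset.mem_univ i)
      _ ≤ ∑ j : s, (((c j) ^ 2 * (y j : ℝ) ^ 2 + b j * y j) + (b j) ^ 2 / (2 * (c j) ^ 2)) :=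
          Finset.sum_le_sum fun j _ => h1 j
      _ = B := by rw [Finset.sum_add_distrib, hy, zero_add]
  choose n hn using fun i : s => exists_nat_gt (B / ((c i) ^ 2 / 2))
  refine Set.Finite.subset (Set.Finite.pi' (t := fun i : s => Set.Icc (-(n i : ℤ)) (n i))
    fun i => Set.finite_Icc _ _) ?_
  intro y hy i
  have h1 := key y hy i
  have hci := hc i i.2
  have h2 : (y i : ℝ) ^ 2 ≤ B / ((c i) ^ 2 / 2) := by
    rw [le_div_iff₀ (by positivity)]; linarith
  have h3 : ((y i) ^ 2 : ℤ) < n i := by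
    have := lt_of_le_of_lt h2 (hn i)
    exact_mod_cast this
  rw [Set.mem_Icc]
  constructor <;> nlinarith

theorem RD.int_val (a : Module.Dual ℂ H) (ha : a ∈ D.R) :
    ∃ c : ℝ, 0 < c ∧ ∀ ν ∈ AddSubgroup.closure (D.R : Set (Module.Dual ℂ H)),
      ∃ n : ℤ, ν (D.t a) = c * n := by
  obtain ⟨c, hc, _, h⟩ := D.cr a ha
  refine ⟨c, hc, fun ν hν => ?_⟩
  induction hν using AddSubgroup.closure_induction with
  | mem x hx => exact h x hx
  | zero => exact ⟨0, by simp⟩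
  | add x y _ _ hx hy =>
    obtain ⟨n, hn⟩ := hx
    obtain ⟨m, hm⟩ := hy
    exact ⟨n + m, by rw [LinearMap.add_apply, hn, hm]; push_cast; ring⟩
  | neg x _ hx =>
    obtain ⟨n, hn⟩ := hx
    exact ⟨-n, by rw [LinearMap.neg_apply, hn]; push_cast; ring⟩

theorem RD.fin_hw (Q : Finset (Module.Dual ℂ H)) (hQ : Q ⊆ D.R) (l0 : Module.Dual ℂ H) :
    Set.Finite {l | l - l0 ∈ AddSubgroup.closure (D.R : Set (Module.Dual ℂ H)) ∧
      D.q Q l = D.q Q l0} := by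
  classical
  choose! c hc hint using D.int_val
  choose! n hn using hint
  let b : Module.Dual ℂ H → ℝ := fun a => (2 * l0 (D.t a) * c a + if a ∈ Q then (c a : ℂ) else 0 : ℂ).re
  have hfin := fin_quad D.R c b hc
  refine Set.Finite.of_finite_image (f := fun l => fun i : D.R => n i (l - l0))
    (hfin.subset ?_) ?_
  · rintro _ ⟨l, ⟨hl, hq⟩, rfl⟩
    rw [Set.mem_ofPred_eq]
    have e1 : ∀ a ∈ D.R, l (D.t a) = l0 (D.t a) + c a * n a (l - l0) := by
      intro a ha
      rw [← hn a ha _ hl, LinearMap.sub_apply]; ring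
    have e2 : ∑ a ∈ D.R, (((c a) ^ 2 * (n a (l - l0) : ℂ) ^ 2)
        + (2 * l0 (D.t a) * c a + if a ∈ Q then (c a : ℂ) else 0) * n a (l - l0)) = 0 := by
      have e3 : D.q Q l - D.q Q l0 = 0 := sub_eq_zero.2 hq
      refine Eq.trans ?_ e3
      rw [RD.q, RD.q]
      have e4 : ∀ m : Module.Dual ℂ H, ∑ a ∈ Q, m (D.t a)
          = ∑ a ∈ D.R, if a ∈ Q then m (D.t a) else 0 := by
        intro m
        rw [← Finset.sum_filter, Finset.filter_mem_eq_inter, Finset.inter_eq_right.2 hQ]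
      rw [e4, e4, ← Finset.sum_add_distrib, ← Finset.sum_add_distrib, ← Finset.sum_sub_distrib]
      refine Finset.sum_congr rfl fun a ha => ?_
      rw [e1 a ha]
      split_ifs <;> ring
    have e5 := congrArg Complex.re e2
    rw [Complex.re_sum, Complex.zero_re, ← Finset.sum_coe_sort] at e5
    rw [← e5]
    refine Finset.sum_congr rfl fun a _ => ?_
    rw [Complex.add_re]
    congr 1
    · rw [← Complex.ofReal_intCast, ← Complex.ofReal_pow, ← Complex.ofReal_pow, ← Complex.ofReal_mul,
        Complex.ofReal_re]
    · rw [← Complex.ofReal_intCast, Complex.re_mul_ofReal]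
  · rintro l ⟨hl, _⟩ l' ⟨hl', _⟩ h
    have h1 : ∀ a ∈ D.R, l (D.t a) = l' (D.t a) := by
      intro a ha
      have h2 := congrFun h ⟨a, ha⟩
      have h3 := hn a ha _ hl
      have h4 := hn a ha _ hl'
      simp only at h2
      rw [h2, ← h4] at h3
      simpa using h3
    apply LinearMap.ext_on_range (v := fun a : D.R => D.t a) (hv := ?_) (fun a => h1 a a.2)
    rw [← D.tspan]; congr 1
    ext x; simp

/-- highest weights in a module generated by a highest weight vector form a finite set -/
theorem RD.fin_hi (hρ : IsRep ρ) {Q : Finset (Module.Dual ℂ H)}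
    (hQ : D.IsPS Q) {l0 : Module.Dual ℂ H} {v0 : V} (hv0 : D.IsHi Q ρ l0 v0) :
    Set.Finite {l | ∃ v ∈ rgen ρ {v0}, D.IsHi Q ρ l v} := by
  refine (D.fin_hw Q hQ.sub l0).subset ?_
  rintro l ⟨v, hv, hi⟩
  constructor
  · let S : Set (Module.Dual ℂ H) :=
      {l | l - l0 ∈ AddSubgroup.closure (D.R : Set (Module.Dual ℂ H))}
    refine wt_mem_of_mem_iSup (ρ := ρ) S l v hi.1 hi.2.1 ?_
    refine rgen_le (ρ := ρ) ?_ ?_ hv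
    · apply D.stb_of
      · intro h w hw
        have : (⨆ m : S, rwt H ρ (m : Module.Dual ℂ H)) ≤
          (⨆ m : S, rwt H ρ (m : Module.Dual ℂ H)).comap (ρ h) := by
          refine iSup_le fun m w hw => Submodule.mem_iSup_of_mem m ?_
          rw [hw h]; exact Submodule.smul_mem _ _ hw
        exact this hw
      · intro a ha w hw
        have : (⨆ m : S, rwt H ρ (m : Module.Dual ℂ H)) ≤
          (⨆ m : S, rwt H ρ (m : Module.Dual ℂ H)).comap (ρ (D.e a)) := by
          refine iSup_le fun m w hw => ?_
          have hm : (m : Module.Dual ℂ H) + a ∈ S := by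
            have := add_mem m.2 (AddSubgroup.subset_closure (show a ∈ (D.R : Set _) from ha))
            rw [Set.mem_ofPred_eq, add_sub_right_comm]
            exact this
          exact Submodule.mem_iSup_of_mem (⟨_, hm⟩ : S) (map_rwt hρ (D.wt a ha) hw)
        exact this hw
    · rw [Set.singleton_subset_iff]
      have h0 : l0 ∈ S := by rw [Set.mem_ofPred_eq, sub_self]; exact zero_mem _
      exact Submodule.mem_iSup_of_mem (⟨_, h0⟩ : S) hv0.2.1
  · have h1 : rgen ρ {v0} ≤ LinearMap.ker (D.cas ρ - D.q Q l0 • 1) := by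
      apply rgen_le
      · intro y w hw
        rw [LinearMap.mem_ker] at hw ⊢
        have : (D.cas ρ - D.q Q l0 • 1) * ρ y = ρ y * (D.cas ρ - D.q Q l0 • 1) := by
          rw [sub_mul, mul_sub, D.cas_comm hρ]; simp
        rw [← Module.End.mul_apply, this, Module.End.mul_apply, hw, map_zero]
      · rw [Set.singleton_subset_iff, SetLike.mem_coe, LinearMap.mem_ker]
        simp [D.cas_hi hρ hQ hv0]
    have h2 := h1 hv
    rw [LinearMap.mem_ker] at h2
    simp only [LinearMap.sub_apply, D.cas_hi hρ hQ hi, LinearMap.smul_apply, Module.End.one_apply,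
      ← sub_smul, smul_eq_zero, hi.1, or_false, sub_eq_zero] at h2
    exact h2

end Root

section Key

variable {L : Type*} [LieRing L] [LieAlgebra ℂ L]
variable {H : LieSubalgebra ℂ L} (D : RD H) {V : Type*} [AddCommGroup V] [Module ℂ V]
  {ρ : L →ₗ[ℂ] Module.End ℂ V}

theorem RD.lemmaB (hρ : IsRep ρ) (hwt : IsWt H ρ) {a : Module.Dual ℂ H} (ha : a ∈ D.R)
    (hnil : ∀ v, ∃ n : ℕ, ((ρ (D.e a)) ^ n) v = 0) : Evt H ρ a := by
  obtain ⟨c, hc, hac, _⟩ := D.cr a ha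
  have hc0 : (c : ℂ) ≠ 0 := by exact_mod_cast hc.ne'
  refine Paper.lemmaB (e := D.e a) (f := (c : ℂ)⁻¹ • D.f a) (h := (c : ℂ)⁻¹ • D.t a) hρ hwt
    (D.wt a ha) ?_ ?_ ?_ hnil
  · intro h
    rw [lie_smul, D.wtf a ha, smul_comm]
  · rw [lie_smul, D.eft a ha]; rfl
  · rw [map_smul, hac, smul_eq_mul]; field_simp

theorem RD.exists_hi (hρ : IsRep ρ) (hwt : IsWt H ρ) {Q : Finset (Module.Dual ℂ H)}
    (hQ : D.IsPS Q) (h0 : (0 : Module.Dual ℂ H) ∉ AddSubsemigroup.closure (Q : Set (Module.Dual ℂ H)))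
    (hev : ∀ a ∈ Q, Evt H ρ a) {N : Submodule ℂ V} (hN : Stb ρ N) (hN0 : N ≠ ⊥) :
    ∃ l, ∃ v ∈ N, D.IsHi Q ρ l v := by
  classical
  set Cl := AddSubsemigroup.closure (Q : Set (Module.Dual ℂ H)) with hCl
  have hQC : ∀ a ∈ Q, a ∈ Cl := fun a ha => AddSubsemigroup.subset_closure ha
  have hadd : ∀ a ∈ Q, ∀ p ∈ Q, a + p ∈ D.R → a + p ∈ Q := by
    intro a ha p hp h
    refine (hQ.cov _ h).resolve_right fun h' => h0 ?_
    have := Cl.add_mem (Cl.add_mem (hQC a ha) (hQC p hp)) (hQC _ h')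
    rwa [add_neg_cancel] at this
  suffices main : ∀ n, ∀ A ⊆ Q, (Q \ A).card = n →
      (∀ a ∈ A, ∀ p ∈ Q, a + p ∈ D.R → a + p ∈ A) →
      (∃ l, ∃ v ∈ N, v ≠ 0 ∧ v ∈ rwt H ρ l ∧ ∀ a ∈ A, ρ (D.e a) v = 0) →
      ∃ l, ∃ v ∈ N, D.IsHi Q ρ l v by
    obtain ⟨l, v, hv, hv0, hvl⟩ := hN.exists_wt hwt.1 hN0
    exact main _ ∅ (by simp) rfl (by simp) ⟨l, v, hv, hv0, hvl, by simp⟩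
  intro n
  induction n with
  | zero =>
    rintro A hA hc _ ⟨l, v, hv, hv0, hvl, hk⟩
    rw [Finset.card_eq_zero, Finset.sdiff_eq_empty_iff_subset] at hc
    exact ⟨l, v, hv, hv0, hvl, fun a ha => hk a (hc ha)⟩
  | succ n ih =>
    rintro A hA hc hup ⟨l, v, hv, hv0, hvl, hk⟩
    let r : Module.Dual ℂ H → Module.Dual ℂ H → Prop := fun a b => a - b ∈ Cl
    have hstr : IsStrictOrder (Module.Dual ℂ H) r :=
      { irrefl := fun a h => h0 (by simpa [r] using h)
        trans := fun a b c hab hbc => by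
          have := Cl.add_mem hab hbc
          rwa [sub_add_sub_cancel] at this }
    have hwf : Set.WellFoundedOn (↑(Q \ A) : Set (Module.Dual ℂ H)) r :=
      Set.Finite.wellFoundedOn (Finset.finite_toSet _)
    have hne : (Q \ A).Nonempty := by rw [← Finset.card_pos]; omega
    obtain ⟨x, hx⟩ := hne
    obtain ⟨⟨α, hα⟩, _, hmin⟩ := WellFounded.has_min hwf Set.univ ⟨⟨x, hx⟩, trivial⟩
    rw [Finset.mem_coe, Finset.mem_sdiff] at hα
    have hαR := hQ.sub hα.1
    have hup' : ∀ p ∈ Q, α + p ∈ D.R → α + p ∈ A := by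
      intro p hp h
      by_contra hnA
      have h1 : α + p ∈ Q \ A := Finset.mem_sdiff.2 ⟨hadd _ hα.1 _ hp h, hnA⟩
      refine hmin ⟨α + p, h1⟩ trivial ?_
      show α + p - α ∈ Cl
      rw [add_sub_cancel_left]; exact hQC p hp
    -- powers of e_α preserve the kernel
    have hpres : ∀ j : ℕ, ∀ a ∈ A, ρ (D.e a) (((ρ (D.e α)) ^ j) v) = 0 := by
      intro j
      induction j with
      | zero => simpa using hk
      | succ j ihj =>
        intro a ha
        set w := ((ρ (D.e α)) ^ j) v
        rw [pow_succ', Module.End.mul_apply]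
        have h1 := hρ (D.e a) (D.e α) w
        rw [ihj a ha, map_zero, sub_zero] at h1
        rw [← h1]
        have hne0 : a + α ≠ 0 := by
          intro h
          exact h0 (h ▸ Cl.add_mem (hQC a (hA ha)) (hQC α hα.1))
        rcases D.brk a (hQ.sub (hA ha)) α hαR hne0 with ⟨h2, c, hc⟩ | h2
        · rw [hc, map_smul, LinearMap.smul_apply, ihj _ (hup a ha α hα.1 h2), smul_zero]
        · rw [h2, map_zero, LinearMap.zero_apply]
    have hpN : ∀ j : ℕ, ((ρ (D.e α)) ^ j) v ∈ N := by
      intro j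
      induction j with
      | zero => simpa using hv
      | succ j ihj => rw [pow_succ']; exact hN _ _ ihj
    have hex := (hev α hα.1).nilp hwt.1 hρ (D.wt α hαR) v
    have hj1 := Nat.find_spec hex
    have hjpos : Nat.find hex ≠ 0 := by
      intro h0
      rw [h0] at hj1
      exact hv0 (by simpa using hj1)
    obtain ⟨i, hi⟩ := Nat.exists_eq_succ_of_ne_zero hjpos
    have hw0 : ((ρ (D.e α)) ^ i) v ≠ 0 := Nat.find_min hex (by omega)
    refine ih (insert α A) (Finset.insert_subset hα.1 hA) ?_ ?_
      ⟨_, _, hpN i, hw0, map_rwt_pow hρ (D.wt α hαR) i hvl, ?_⟩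
    · rw [Finset.sdiff_insert, Finset.card_erase_of_mem (Finset.mem_sdiff.2 hα), hc]; rfl
    · intro a ha p hp h
      rcases Finset.mem_insert.1 ha with rfl | ha
      · exact Finset.mem_insert_of_mem (hup' p hp h)
      · exact Finset.mem_insert_of_mem (hup a ha p hp h)
    · intro a ha
      rcases Finset.mem_insert.1 ha with rfl | ha
      · rw [hi, Nat.succ_eq_add_one, pow_succ'] at hj1; exact hj1
      · exact hpres i a ha

theorem RD.case_hw (hρ : IsRep ρ) (hwt : IsWt H ρ) [Nontrivial V] {Q : Finset (Module.Dual ℂ H)}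
    (hQ : D.IsPS Q) (h0 : (0 : Module.Dual ℂ H) ∉ AddSubsemigroup.closure (Q : Set (Module.Dual ℂ H)))
    (hev : ∀ a ∈ Q, Evt H ρ a) : ∃ T, IsMinS ρ T := by
  classical
  obtain ⟨l0, v0, _, hv0⟩ := D.exists_hi hρ hwt hQ h0 hev (N := ⊤) (fun _ _ _ => trivial) top_ne_bot
  have hfin := D.fin_hi hρ hQ hv0
  set F := hfin.toFinset
  let X : Submodule ℂ V := ⨆ l ∈ F, rwt H ρ l
  have hXfd : FiniteDimensional ℂ X := by
    have := hwt.2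
    exact Submodule.finiteDimensional_finset_sup F (rwt H ρ) |> fun h => by
      rw [Finset.sup_eq_iSup] at h; exact h
  have hX : ∀ N ≤ rgen ρ {v0}, Stb ρ N → N ≠ ⊥ → N ⊓ X ≠ ⊥ := by
    intro N hN hNs hN0
    obtain ⟨l, v, hv, hi⟩ := D.exists_hi hρ hwt hQ h0 hev hNs hN0
    have hl : l ∈ F := by
      rw [Set.Finite.mem_toFinset]; exact ⟨v, hN hv, hi⟩
    rw [Submodule.ne_bot_iff]
    exact ⟨v, ⟨hv, Submodule.mem_iSup_of_mem l (Submodule.mem_iSup_of_mem hl hi.2.1)⟩, hi.1⟩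
  let S : Set (Submodule ℂ V) := {N | N ≤ rgen ρ {v0} ∧ Stb ρ N ∧ N ≠ ⊥}
  have hS : S.Nonempty := ⟨rgen ρ {v0}, le_rfl, rgen_stb _, by
    intro h
    have : v0 ∈ rgen ρ {v0} := subset_rgen _ rfl
    rw [h] at this
    exact hv0.1 (by simpa using this)⟩
  obtain ⟨N, ⟨hN1, hN2, hN3⟩, hmin⟩ := exists_minimalFor_of_wellFoundedLT (· ∈ S)
    (fun N => Module.finrank ℂ (N ⊓ X : Submodule ℂ V)) hS
  have hle : rgen ρ ((N ⊓ X : Submodule ℂ V) : Set V) ≤ N := rgen_le hN2 fun v hv => hv.1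
  refine ⟨rgen ρ ((N ⊓ X : Submodule ℂ V) : Set V), rgen_stb _, ?_, ?_⟩
  · intro h
    apply hX N hN1 hN2 hN3
    rw [eq_bot_iff, ← h]
    exact subset_rgen _
  · intro W hW hWs hW0
    have h1 : W ⊓ X ≤ N ⊓ X := inf_le_inf_right _ (hW.trans hle)
    have h2 : Module.finrank ℂ (N ⊓ X : Submodule ℂ V) ≤ Module.finrank ℂ (W ⊓ X : Submodule ℂ V) := by
      by_contra! hlt
      exact absurd (hmin (j := W) ⟨(hW.trans hle).trans hN1, hWs, hW0⟩ hlt.le) (not_le.2 hlt)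
    have hfd : FiniteDimensional ℂ (N ⊓ X : Submodule ℂ V) :=
      Submodule.finiteDimensional_of_le inf_le_right
    have h3 := Submodule.eq_of_le_of_finrank_le h1 h2
    apply rgen_le hWs
    rw [← h3]
    exact fun v hv => hv.1

theorem nsmul_mem_cl {A : Type*} [AddCommGroup A] (C : AddSubsemigroup A) {s : A} (hs : s ∈ C)
    (n : ℕ) (hn : n ≠ 0) : n • s ∈ C := by
  induction n with
  | zero => exact absurd rfl hn
  | succ n ih =>
    rcases Nat.eq_zero_or_pos n with rfl | h
    · simpa using hs
    · rw [succ_nsmul]; exact C.add_mem (ih (by omega)) hs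

theorem cl_insert {A : Type*} [AddCommGroup A] (Q : Set A) (α x : A)
    (hx : x ∈ AddSubsemigroup.closure (insert α Q)) :
    ∃ n : ℕ, (x = n • α ∧ n ≠ 0) ∨ ∃ s ∈ AddSubsemigroup.closure Q, x = n • α + s := by
  induction hx using AddSubsemigroup.closure_induction with
  | mem x hx =>
    rcases hx with rfl | hx
    · exact ⟨1, Or.inl ⟨by simp, one_ne_zero⟩⟩
    · exact ⟨0, Or.inr ⟨x, AddSubsemigroup.subset_closure hx, by simp⟩⟩
  | add x y _ _ hx hy =>
    obtain ⟨n, hn⟩ := hx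
    obtain ⟨m, hm⟩ := hy
    refine ⟨n + m, ?_⟩
    rcases hn with ⟨rfl, hn⟩ | ⟨s, hs, rfl⟩ <;> rcases hm with ⟨rfl, hm⟩ | ⟨t, ht, rfl⟩
    · exact Or.inl ⟨by rw [add_nsmul], by omega⟩
    · exact Or.inr ⟨t, ht, by rw [add_nsmul]; abel⟩
    · exact Or.inr ⟨s, hs, by rw [add_nsmul]; abel⟩
    · exact Or.inr ⟨s + t, AddSubsemigroup.add_mem _ hs ht, by rw [add_nsmul]; abel⟩

theorem cl_head {A : Type*} [AddCommGroup A] (J : Set A) (x : A)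
    (hx : x ∈ AddSubsemigroup.closure J) :
    x ∈ J ∨ ∃ a ∈ J, ∃ s ∈ AddSubsemigroup.closure J, x = a + s := by
  induction hx using AddSubsemigroup.closure_induction with
  | mem x hx => exact Or.inl hx
  | add x y _ hy h _ =>
    right
    rcases h with h | ⟨a, ha, s, hs, rfl⟩
    · exact ⟨x, h, y, hy, rfl⟩
    · exact ⟨a, ha, s + y, AddSubsemigroup.add_mem _ hs hy, by abel⟩

theorem RD.exists_ps (J : Finset (Module.Dual ℂ H)) (hJ : J ⊆ D.R)
    (h0 : (0 : Module.Dual ℂ H) ∉ AddSubsemigroup.closure (J : Set (Module.Dual ℂ H))) :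
    ∃ Q, J ⊆ Q ∧ D.IsPS Q ∧
      (0 : Module.Dual ℂ H) ∉ AddSubsemigroup.closure (Q : Set (Module.Dual ℂ H)) := by
  classical
  obtain ⟨Q, hQ, hmax⟩ := Finset.exists_max_image (D.R.powerset.filter fun X => J ⊆ X ∧
    (0 : Module.Dual ℂ H) ∉ AddSubsemigroup.closure (X : Set (Module.Dual ℂ H))) Finset.card
    ⟨J, by simp [hJ, h0]⟩
  simp only [Finset.mem_filter, Finset.mem_powerset] at hQ hmax
  obtain ⟨hQR, hJQ, hQ0⟩ := hQ
  refine ⟨Q, hJQ, ⟨hQR, ?_, ?_⟩, hQ0⟩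
  · have key : ∀ α ∈ D.R, α ∉ Q → ∃ n : ℕ, n ≠ 0 ∧
        ∃ s ∈ AddSubsemigroup.closure (Q : Set (Module.Dual ℂ H)), 0 = n • α + s := by
      intro α hα hαQ
      have h1 : (0 : Module.Dual ℂ H) ∈
          AddSubsemigroup.closure (insert α (Q : Set (Module.Dual ℂ H))) := by
        by_contra hcon
        have := hmax (insert α Q) ⟨Finset.insert_subset hα hQR,
          hJQ.trans (Finset.subset_insert _ _), by rwa [Finset.coe_insert]⟩
        rw [Finset.card_insert_of_notMem hαQ] at this
        omega
      obtain ⟨n, ⟨h2, hn⟩ | ⟨s, hs, h2⟩⟩ := cl_insert _ _ _ h1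
      · rcases smul_eq_zero.1 h2.symm with h | h
        · exact absurd h hn
        · exact absurd h (D.ne0 α hα)
      · refine ⟨n, ?_, s, hs, h2⟩
        rintro rfl
        rw [zero_smul, zero_add] at h2
        exact hQ0 (h2 ▸ hs)
    intro α hα
    by_contra! hcon
    obtain ⟨n, hn, s, hs, h1⟩ := key α hα hcon.1
    obtain ⟨m, hm, t, ht, h2⟩ := key (-α) (D.neg α hα) hcon.2
    apply hQ0
    have h3 : s = -(n • α) := (neg_eq_of_add_eq_zero_right h1.symm).symm
    have h4 : t = m • α := by
      have := (neg_eq_of_add_eq_zero_right h2.symm).symm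
      rwa [smul_neg, neg_neg] at this
    have := AddSubsemigroup.add_mem _ (nsmul_mem_cl _ hs m hm) (nsmul_mem_cl _ ht n hn)
    rw [h3, h4, smul_neg, smul_comm m n, neg_add_cancel] at this
    exact this
  · intro a ha hna
    apply hQ0
    have := AddSubsemigroup.add_mem _ (AddSubsemigroup.subset_closure (show a ∈ (Q : Set _) from ha))
      (AddSubsemigroup.subset_closure (show -a ∈ (Q : Set _) from hna))
    rwa [add_neg_cancel] at this

end Key

section Key

variable {L : Type*} [LieRing L] [LieAlgebra ℂ L]
variable {H : LieSubalgebra ℂ L} (D : RD H) {V : Type*} [AddCommGroup V] [Module ℂ V]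
  {ρ : L →ₗ[ℂ] Module.End ℂ V}

theorem quad_solve (c m c0 : ℂ) (hc : c ≠ 0) : ∃ x : ℂ, c0 + x * m - c * (x * (x - 1)) = 0 := by
  obtain ⟨s, hs⟩ := IsAlgClosed.exists_pow_nat_eq (discrim c (-(c + m)) (-c0)) (n := 2) (by norm_num)
  obtain ⟨x, hx⟩ := exists_quadratic_eq_zero hc ⟨s, by rw [← hs]; ring⟩
  exact ⟨x, by linear_combination -hx⟩

theorem RD.f_inj (a : Module.Dual ℂ H) (ha : a ∈ D.R) (h : Function.Injective (ρ (D.e (-a)))) :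
    Function.Injective (ρ (D.f a)) := by
  obtain ⟨c, hc, hf⟩ := D.fe a ha
  intro v w hvw
  rw [hf, map_smul, LinearMap.smul_apply, LinearMap.smul_apply] at hvw
  exact h (smul_right_injective _ hc hvw)

theorem rres_inj {W : Submodule ℂ V} {hW : Stb ρ W} {y : L} (h : Function.Injective (ρ y)) :
    Function.Injective (rres ρ W hW y) := by
  intro v w hvw
  exact Subtype.ext (h (by simpa using congrArg Subtype.val hvw))

theorem RD.sat_evt (hρ : IsRep ρ) (hwt : IsWt H ρ) {a : Module.Dual ℂ H} (ha : a ∈ D.R)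
    (x : L) (c : ℂ) (hx : D.e a = c • x) (hxn : ∃ N, ∀ y, ((LieAlgebra.ad ℂ L x) ^ N) y = 0) :
    Evt H (rres ρ (rsat ρ ⊥ stb_bot x) (rsat_stb hρ stb_bot x hxn)) a := by
  refine D.lemmaB (hρ.rres _ _) (hwt.rres _ _) ha ?_
  rintro ⟨v, n, hn⟩
  refine ⟨n, Subtype.ext ?_⟩
  rw [rres_pow, hx, map_smul, smul_pow, LinearMap.smul_apply]
  have hn' : ((ρ x) ^ n) v = 0 := by simpa using hn
  rw [hn', smul_zero]; rfl

theorem RD.tw_step (hρ : IsRep ρ) (hwt : IsWt H ρ) [Nontrivial V] {b : Module.Dual ℂ H}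
    (hb : b ∈ D.R) (hE : Function.Injective (ρ (D.e b))) (hF : Function.Injective (ρ (D.f b))) :
    ∃ σ : L →ₗ[ℂ] Module.End ℂ V, IsRep σ ∧ IsWt H σ ∧ (∀ a, Evt H ρ a → Evt H σ a) ∧
      (∃ W, ∃ hW : Stb σ W, W ≠ ⊥ ∧ Evt H (rres σ W hW) (-b)) ∧
      ∀ T, IsMinS σ T → ∃ T', IsMinS ρ T' := by
  obtain ⟨c, hc, hac, -⟩ := D.cr b hb
  have hc0 : (c : ℂ) ≠ 0 := by exact_mod_cast hc.ne'
  have hsurj := surj_of_inj hρ hwt (D.wt b hb) (D.wtf b hb) hE hF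
  let Eq := LinearEquiv.ofBijective (ρ (D.e b)) ⟨hE, hsurj⟩
  let E' : Module.End ℂ V := Eq.symm.toLinearMap
  have k1 : ∀ v, ρ (D.e b) (E' v) = v := fun v => Eq.apply_symm_apply v
  have k2 : ∀ v, E' (ρ (D.e b) v) = v := fun v => Eq.symm_apply_apply v
  have h1 : ρ (D.e b) * E' = 1 := by ext v; exact k1 v
  have h2 : E' * ρ (D.e b) = 1 := by ext v; exact k2 v
  have hstE : ∀ X : Submodule ℂ V, Stb ρ X → ∀ w ∈ X, E' w ∈ X := by
    intro X hX w hw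
    obtain ⟨u, hu⟩ := surj_of_inj (hρ.rres X hX) (hwt.rres X hX) (D.wt b hb) (D.wtf b hb)
      (rres_inj hE) (rres_inj hF) ⟨w, hw⟩
    have : ρ (D.e b) u = w := by simpa using congrArg Subtype.val hu
    rw [← this, k2]; exact u.2
  obtain ⟨N0, hN0⟩ := D.adnil b hb
  set N := N0 + 3 with hNdef
  have hN : ∀ y, ((LieAlgebra.ad ℂ L (D.e b)) ^ N) y = 0 := by
    intro y
    rw [hNdef, add_comm, pow_add, Module.End.mul_apply, hN0, map_zero]
  have hN3 : 3 ≤ N := by omega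
  have heh : ∀ h : H, ⁅D.e b, (h : L)⁆ = -(b h • D.e b) := by
    intro h; rw [← lie_skew, D.wt b hb]
  -- eigenvector
  obtain ⟨l, w0, -, hw0, hw0l⟩ := Stb.exists_wt (ρ := ρ) (W := ⊤) hwt.1 (fun _ _ _ => trivial) top_ne_bot
  have := hwt.2 l
  have hmaps : ∀ v ∈ rwt H ρ l, (ρ (D.f b) * ρ (D.e b)) v ∈ rwt H ρ l := by
    intro v hv
    have := map_rwt hρ (D.wtf b hb) (map_rwt hρ (D.wt b hb) hv)
    rwa [add_neg_cancel_right] at this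
  have : Nontrivial (rwt H ρ l) := ⟨⟨⟨w0, hw0l⟩, 0, fun h => hw0 (congrArg Subtype.val h)⟩⟩
  obtain ⟨c0, hc0'⟩ := Module.End.exists_eigenvalue ((ρ (D.f b) * ρ (D.e b)).restrict hmaps)
  obtain ⟨w, hw⟩ := hc0'.exists_hasEigenvector
  have hwl : (w : V) ∈ rwt H ρ l := w.2
  have hwv : ρ (D.f b) (ρ (D.e b) w) = c0 • (w : V) := by
    have := congrArg Subtype.val hw.apply_eq_smul
    simpa using this
  have hwne : (w : V) ≠ 0 := fun h => hw.2 (Subtype.ext h)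
  obtain ⟨x, hx⟩ := quad_solve c (l (D.t b)) c0 hc0
  set σ := tw ρ (D.e b) E' N x with hσ
  have hσR : IsRep σ := tw_isRep hρ h1 h2 hN x
  have hσe : σ (D.e b) = ρ (D.e b) := by
    ext v
    rw [hσ, tw_three hN3 x _ _ (by simp)]; simp
  have hσh : ∀ (h : H) v, σ h v = ρ h v - (x * b h) • v := by
    intro h v
    rw [hσ, tw_three hN3 x _ _ (by simp [heh])]
    simp [heh, k1, mul_smul, sub_eq_add_neg]
  have hrw : ∀ m, rwt H σ m = rwt H ρ (m + x • b) := by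
    intro m
    ext v
    rw [mem_rwt, mem_rwt]
    refine forall_congr' fun h => ?_
    rw [hσh, LinearMap.add_apply, LinearMap.smul_apply, smul_eq_mul, add_smul, sub_eq_iff_eq_add]
  have hσwt : IsWt H σ := by
    refine ⟨?_, fun m => by rw [hrw]; exact hwt.2 _⟩
    rw [eq_top_iff, ← hwt.1]
    refine iSup_le fun m => ?_
    refine le_trans (le_of_eq ?_) (le_iSup _ (m - x • b))
    rw [hrw, sub_add_cancel]
  have hσf : σ (D.f b) (ρ (D.e b) w) = 0 := by
    have e3 : ⁅D.e b, ⁅D.e b, D.f b⁆⁆ = -((2 * c : ℂ) • D.e b) := by rw [D.eft b hb, heh, hac]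
    rw [hσ, tw_three hN3 x _ _ (by rw [e3]; simp), e3, D.eft b hb, k2, hwv, hwl (D.t b), map_neg, map_smul,
      LinearMap.neg_apply, LinearMap.smul_apply, k1]
    have : (c0 + x * l (D.t b) - c * (x * (x - 1))) • (w : V) = 0 := by rw [hx, zero_smul]
    rw [← this]; module
  refine ⟨σ, hσR, hσwt, ?_, ⟨_, rsat_stb hσR stb_bot (D.f b) (D.fnil b hb), ?_, ?_⟩, ?_⟩
  · intro a ha m
    obtain ⟨n0, hn0⟩ := ha (m + x • b)
    refine ⟨n0, fun n hn => ?_⟩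
    rw [hrw, ← hn0 n hn]; congr 1; abel
  · intro h
    have : ρ (D.e b) w ∈ rsat σ ⊥ stb_bot (D.f b) := ⟨1, by simpa using hσf⟩
    rw [h, Submodule.mem_bot] at this
    exact hwne (hE (by rw [this, map_zero]))
  · obtain ⟨d, hd, hfd⟩ := D.fe b hb
    exact D.sat_evt hσR hσwt (D.neg b hb) (D.f b) d⁻¹ (by rw [hfd, smul_smul, inv_mul_cancel₀ hd, one_smul])
      (D.fnil b hb)
  · intro T hT
    have hKs := rsat_stb hσR hT.1 (D.e b) ⟨N, hN⟩
    set K := rsat σ T hT.1 (D.e b)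
    have hKE : ∀ w ∈ K, ρ (D.e b) w ∈ K := fun w hw => by
      have := hKs (D.e b) w hw; rwa [hσe] at this
    have hKE' : ∀ w ∈ K, E' w ∈ K := by
      rintro w ⟨n, hn⟩
      refine ⟨n + 1, ?_⟩
      rw [hσe] at hn ⊢
      rwa [pow_succ, Module.End.mul_apply, k1]
    refine ⟨K, stb_of_tw_stb hρ h1 h2 (by omega) hN x hKs hKE hKE', ?_, ?_⟩
    · intro h
      apply hT.2.1
      rw [eq_bot_iff, ← h]
      intro v hv
      exact ⟨0, by simpa using hv⟩
    · intro X hXK hX hX0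
      have hXE' := hstE X hX
      have hXσ : Stb σ X := tw_stb_of_stb x hX hXE'
      have hXT : T ≤ X := by
        refine le_trans (hT.2.2 (X ⊓ T) inf_le_right (fun y w hw => ⟨hXσ y w hw.1, hT.1 y w hw.2⟩) ?_) inf_le_left
        intro h
        obtain ⟨v, hv, hv0⟩ := Submodule.exists_mem_ne_zero_of_ne_bot hX0
        obtain ⟨n, hn⟩ := hXK hv
        have hnX : ∀ n : ℕ, ((ρ (D.e b)) ^ n) v ∈ X := by
          intro n
          induction n with
          | zero => simpa using hv
          | succ n ih => rw [pow_succ', Module.End.mul_apply]; exact hX _ _ ih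
        rw [hσe] at hn
        have h3 : ((ρ (D.e b)) ^ n) v ∈ X ⊓ T := ⟨hnX n, hn⟩
        rw [h, Submodule.mem_bot] at h3
        have := pow_cancel h2 n v
        rw [h3, map_zero] at this
        exact hv0 this.symm
      rintro v ⟨n, hn⟩
      rw [hσe] at hn
      have h4 := hXT hn
      rw [← pow_cancel h2 n v]
      generalize ((ρ (D.e b)) ^ n) v = u at h4 ⊢
      induction n generalizing u with
      | zero => simpa using h4
      | succ n ih =>
        rw [pow_succ', Module.End.mul_apply]
        refine hXE' _ ?_
        clear hn
        clear ih
        induction n with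
        | zero => simpa using h4
        | succ n ih => rw [pow_succ', Module.End.mul_apply]; exact hXE' _ ih

end Key

section Key2

universe u v
variable {L : Type v} [LieRing L] [LieAlgebra ℂ L]
variable {H : LieSubalgebra ℂ L} (D : RD H)

theorem RD.key (n : ℕ) : ∀ (A : Finset (Module.Dual ℂ H)), A ⊆ D.R → A.card < n →
    ∀ (V : Type u) [AddCommGroup V] [Module ℂ V]
    (ρ : L →ₗ[ℂ] Module.End ℂ V), IsRep ρ → IsWt H ρ → Nontrivial V →
    (∀ a ∈ D.R, a ∉ A → Evt H ρ a) → ∃ T, IsMinS ρ T := by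
  classical
  induction n with
  | zero => intro A _ hA; omega
  | succ n ih =>
    intro A hAR hA V _ _ ρ hρ hwt hV hev
    -- shrink
    have shrink : ∀ (σ : L →ₗ[ℂ] Module.End ℂ V), IsRep σ → IsWt H σ →
        (∀ a ∈ D.R, a ∉ A → Evt H σ a) → ∀ a0 ∈ A, ∀ W (hW : Stb σ W), W ≠ ⊥ →
        Evt H (rres σ W hW) a0 → ∃ T, IsMinS σ T := by
      intro σ hσ hσwt hσev a0 ha0 W hW hW0 hE
      obtain ⟨T, hT⟩ := ih (A.erase a0) ((Finset.erase_subset _ _).trans hAR)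
        (by rw [Finset.card_erase_of_mem ha0]; have := Finset.card_pos.2 ⟨a0, ha0⟩; omega) W
        (rres σ W hW) (hσ.rres W hW) (hσwt.rres W hW) ((Submodule.nontrivial_iff_ne_bot).2 hW0) (by
          intro a ha haA
          by_cases h : a = a0
          · rw [h]; exact hE
          · exact (hσev a ha (fun h' => haA (Finset.mem_erase.2 ⟨h, h'⟩))).rres W hW)
      exact ⟨_, hT.of_rres⟩
    have hinj : (∃ T, IsMinS ρ T) ∨ ∀ a ∈ A, Function.Injective (ρ (D.e a)) := by
      by_contra! h
      obtain ⟨hno, a, ha, hi⟩ := h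
      have hW := rsat_stb hρ stb_bot (D.e a) (D.adnil a (hAR ha))
      obtain ⟨T, hT⟩ := shrink ρ hρ hwt hev a ha _ hW (by
        intro h
        apply hi
        rw [← LinearMap.ker_eq_bot, eq_bot_iff, ← h]
        intro v hv
        exact ⟨1, by simpa using hv⟩) (D.sat_evt hρ hwt (hAR ha) (D.e a) 1 (by simp) (D.adnil a (hAR ha)))
      exact hno T hT
    rcases hinj with h | hinj
    · exact h
    by_cases hb : ∃ b ∈ A, -b ∈ A
    · obtain ⟨b, hb, hb'⟩ := hb
      obtain ⟨σ, hσ, hσwt, hσev, ⟨W, hW, hW0, hWE⟩, hfin⟩ := D.tw_step hρ hwt (hAR hb) (hinj b hb)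
        (D.f_inj b (hAR hb) (hinj _ hb'))
      obtain ⟨T, hT⟩ := shrink σ hσ hσwt (fun a ha haA => hσev a (hev a ha haA)) (-b) hb' W hW hW0 hWE
      exact hfin T hT
    · push Not at hb
      by_cases hA' : ∃ a ∈ A, Evt H ρ a
      · obtain ⟨a, ha, hE⟩ := hA'
        exact shrink ρ hρ hwt hev a ha ⊤ (fun _ _ _ => trivial) top_ne_bot (hE.rres _ _)
      push Not at hA'
      set J := D.R.filter (fun a => -a ∈ A) with hJ
      have hJmem : ∀ a, a ∈ J ↔ a ∈ D.R ∧ -a ∈ A := fun a => by rw [hJ, Finset.mem_filter]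
      have hdown : ∀ s ∈ AddSubsemigroup.closure (J : Set (Module.Dual ℂ H)), ∀ l,
          rwt H ρ l ≠ ⊥ → rwt H ρ (l - s) ≠ ⊥ := by
        intro s hs
        induction hs using AddSubsemigroup.closure_induction with
        | mem a ha =>
          intro l hl
          have ha := (hJmem a).1 ha
          obtain ⟨v, hv, hv0⟩ := Submodule.exists_mem_ne_zero_of_ne_bot hl
          intro hbot
          have := map_rwt hρ (D.wt _ (D.neg a ha.1)) hv
          rw [← sub_eq_add_neg, hbot, Submodule.mem_bot] at this
          exact hv0 (hinj _ ha.2 (by rw [this, map_zero]))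
        | add x y _ _ hx hy =>
          intro l hl
          rw [← sub_sub]
          exact hy _ (hx _ hl)
      have h0 : (0 : Module.Dual ℂ H) ∉ AddSubsemigroup.closure (J : Set (Module.Dual ℂ H)) := by
        intro h0
        rcases cl_head _ _ h0 with h | ⟨a, ha, s, hs, has⟩
        · exact D.ne0 0 ((hJmem 0).1 h).1 rfl
        · have ha := (hJmem a).1 ha
          have hs' : s = -a := by rw [eq_neg_iff_add_eq_zero, add_comm]; exact has.symm
          have haA : a ∉ A := fun h => hb a h ha.2
          obtain ⟨l, v, -, hv0, hvl⟩ := Stb.exists_wt (ρ := ρ) (W := ⊤) hwt.1 (fun _ _ _ => trivial) top_ne_bot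
          have hup : ∀ n : ℕ, rwt H ρ (l + n • a) ≠ ⊥ := by
            intro n
            induction n with
            | zero =>
              intro h
              rw [zero_smul, add_zero] at h
              rw [h, Submodule.mem_bot] at hvl
              exact hv0 hvl
            | succ n ih =>
              have := hdown s hs _ ih
              rw [hs', sub_neg_eq_add] at this
              rwa [succ_nsmul, ← add_assoc]
          obtain ⟨m, hm⟩ := hev a ha.1 haA l
          exact hup m (hm m le_rfl)
      obtain ⟨Q, hJQ, hQ, hQ0⟩ := D.exists_ps J (Finset.filter_subset _ _) h0
      refine D.case_hw hρ hwt hQ hQ0 ?_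
      intro a ha
      refine hev a (hQ.sub ha) fun haA => ?_
      have : -a ∈ Q := hJQ ((hJmem _).2 ⟨D.neg a (hQ.sub ha), by rwa [neg_neg]⟩)
      exact hQ0 (by
        have := add_mem (AddSubsemigroup.subset_closure (Finset.mem_coe.2 ha))
          (AddSubsemigroup.subset_closure (Finset.mem_coe.2 this))
        rwa [add_neg_cancel] at this)

theorem RD.exists_min (D : RD H) {V : Type u} [AddCommGroup V] [Module ℂ V] [Nontrivial V]
    {ρ : L →ₗ[ℂ] Module.End ℂ V} (hρ : IsRep ρ) (hwt : IsWt H ρ) : ∃ T, IsMinS ρ T :=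
  D.key _ D.R subset_rfl (Nat.lt_succ_self _) V ρ hρ hwt inferInstance (fun _ h h' => absurd h h')

end Key2

section Killing
open LieAlgebra LieAlgebra.IsKilling LieModule

theorem exists_RD {L : Type*} [LieRing L] [LieAlgebra ℂ L] [FiniteDimensional ℂ L]
    [LieAlgebra.IsKilling ℂ L] (H : LieSubalgebra ℂ L) [H.IsCartanSubalgebra] :
    Nonempty (RD H) := by
  classical
  let R : Finset (Module.Dual ℂ H) := H.root.image (Weight.toLinear ℂ H L)
  have memW : ∀ w : Weight ℂ H L, w.IsNonZero → w.toLinear ∈ R := fun w hw =>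
    Finset.mem_image.2 ⟨w, by simpa using hw, rfl⟩
  have wOf : ∀ a ∈ R, ∃ w : Weight ℂ H L, w.IsNonZero ∧ w.toLinear = a := by
    intro a ha
    obtain ⟨w, hw, rfl⟩ := Finset.mem_image.1 ha
    exact ⟨w, by simpa using hw, rfl⟩
  have memR : ∀ a : Module.Dual ℂ H, a ≠ 0 → rootSpace H a ≠ ⊥ → a ∈ R := by
    intro a ha h
    have := memW ⟨a, h⟩ (fun h0 => ha (by ext x; exact congrFun h0 x))
    exact this
  have ne0 : ∀ a ∈ R, a ≠ 0 := by
    intro a ha h0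
    obtain ⟨w, hw, rfl⟩ := wOf a ha
    exact hw (by ext x; exact LinearMap.congr_fun h0 x)
  have hneg : ∀ a ∈ R, -a ∈ R := by
    intro a ha
    obtain ⟨w, hw, rfl⟩ := wOf a ha
    rw [← Weight.toLinear_neg]
    exact memW _ hw.neg
  have exe : ∀ a : Module.Dual ℂ H, ∃ x : L, a ∈ R → x ∈ rootSpace H a ∧ x ≠ 0 := by
    intro a
    by_cases ha : a ∈ R
    · obtain ⟨w, hw, rfl⟩ := wOf a ha
      obtain ⟨x, hx, hx0⟩ := w.exists_ne_zero
      exact ⟨x, fun _ => ⟨hx, hx0⟩⟩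
    · exact ⟨0, fun h => absurd h ha⟩
  choose e he using exe
  have exf : ∀ a : Module.Dual ℂ H, ∃ y : L, a ∈ R → y ∈ rootSpace H (-a) ∧ killingForm ℂ L (e a) y = 1 := by
    intro a
    by_cases ha : a ∈ R
    · have : ∃ y ∈ rootSpace H (-a), killingForm ℂ L (e a) y ≠ 0 := by
        by_contra! h
        have := mem_ker_killingForm_of_mem_rootSpace_of_forall_rootSpace_neg ℂ L H (he a ha).1 h
        rw [ker_killingForm_eq_bot] at this
        exact (he a ha).2 (by simpa using this)
      obtain ⟨y, hy, hk⟩ := this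
      refine ⟨(killingForm ℂ L (e a) y)⁻¹ • y, fun _ => ⟨(rootSpace H (-a)).smul_mem _ hy, ?_⟩⟩
      rw [map_smul, smul_eq_mul, inv_mul_cancel₀ hk]
    · exact ⟨0, fun h => absurd h ha⟩
  choose f hf using exf
  have one : ∀ a ∈ R, ∀ x ∈ rootSpace H a, ∃ c : ℂ, x = c • e a := by
    intro a ha x hx
    obtain ⟨w, hw, rfl⟩ := wOf a ha
    have h1 := finrank_rootSpace_eq_one w hw
    obtain ⟨c, hc⟩ := exists_smul_eq_of_finrank_eq_one h1
      (x := (⟨e w.toLinear, (he _ ha).1⟩ : rootSpace H w)) (fun h => (he _ ha).2 (congrArg Subtype.val h))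
      ⟨x, hx⟩
    exact ⟨c, (congrArg Subtype.val hc).symm⟩
  have kz : ∀ a b : Module.Dual ℂ H, ∀ x ∈ rootSpace H a, ∀ y ∈ rootSpace H b, a + b ≠ 0 →
      killingForm ℂ L x y = 0 := by
    intro a b x hx y hy hab
    refine killingForm_apply_eq_zero_of_mem_rootSpace_of_add_ne_zero ℂ L H hx hy (fun h => hab ?_)
    ext z; exact congrFun h z
  have hH0 : ∀ h : H, (h : L) ∈ rootSpace H (0 : Module.Dual ℂ H) := by
    intro h
    have := rootSpace_zero_eq ℂ L H
    change (h : L) ∈ rootSpace H 0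
    rw [this]; exact h.2
  have fe : ∀ a ∈ R, ∃ c : ℂ, c ≠ 0 ∧ f a = c • e (-a) := by
    intro a ha
    obtain ⟨c, hc⟩ := one (-a) (hneg a ha) (f a) (hf a ha).1
    refine ⟨c, ?_, hc⟩
    rintro rfl
    have := (hf a ha).2
    rw [hc, zero_smul, map_zero] at this
    exact zero_ne_one this
  let t : Module.Dual ℂ H → H := fun a => (cartanEquivDual H).symm a
  have htK : ∀ a, ∀ h : H, killingForm ℂ L (t a) h = a h := by
    intro a h
    have : cartanEquivDual H (t a) h = a h := by rw [LinearEquiv.apply_symm_apply]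
    exact this
  have Ksymm : ∀ a b, killingForm ℂ L a b = killingForm ℂ L b a := fun a b => traceForm_comm ℂ L L a b
  have hfl : ∀ x y, (killingForm ℂ L).flip x y = killingForm ℂ L y x := fun _ _ => rfl
  have hsum : ∀ x y : H, killingForm ℂ L x y = ∑ a ∈ R, a x * a y := by
    intro x y
    have := LinearMap.congr_fun (LinearMap.congr_fun (restrict_killingForm_eq_sum (K := ℂ) (L := L) (H := H)) x) y
    rw [Finset.sum_image]
    · refine Eq.trans this ?_
      simp only [LinearMap.sum_apply, LinearMap.smulRight_apply, LinearMap.smul_apply, smul_eq_mul]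
    · intro a _ b _ hab
      ext z; exact LinearMap.congr_fun hab z
  have span : ∀ y : L, ∃ h : H, ∃ c : Module.Dual ℂ H → ℂ, y = h + ∑ a ∈ R, c a • e a := by
    let g : (H × (Module.Dual ℂ H → ℂ)) →ₗ[ℂ] L := LinearMap.coprod H.toSubmodule.subtype
      (∑ a ∈ R, (LinearMap.proj a : (Module.Dual ℂ H → ℂ) →ₗ[ℂ] ℂ).smulRight (e a))
    have hg : LinearMap.range g = ⊤ := by
      rw [eq_top_iff]
      have h1 := congrArg LieSubmodule.toSubmodule (iSup_genWeightSpace_eq_top' ℂ H L)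
      rw [LieSubmodule.iSup_toSubmodule, LieSubmodule.top_toSubmodule] at h1
      rw [← h1]
      refine iSup_le fun w => ?_
      intro x hx
      by_cases hw : w.IsZero
      · have : x ∈ H := by
          have h2 := rootSpace_zero_eq ℂ L H
          have h3 : x ∈ rootSpace H (0 : H → ℂ) := by
            have : (w : H → ℂ) = 0 := hw
            rw [← this]; exact hx
          rw [h2] at h3; exact h3
        exact ⟨(⟨x, this⟩, 0), by simp [g]; rfl⟩
      · obtain ⟨c, hc⟩ := one _ (memW w hw) x hx
        refine ⟨(0, Pi.single w.toLinear c), ?_⟩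
        simp only [g, LinearMap.coprod_apply, map_zero, zero_add, LinearMap.sum_apply,
          LinearMap.smulRight_apply, LinearMap.proj_apply]
        rw [Finset.sum_eq_single_of_mem _ (memW w hw)]
        · rw [Pi.single_eq_same, hc]
        · intro b _ hb
          rw [Pi.single_eq_of_ne hb, zero_smul]
    intro y
    have : y ∈ LinearMap.range g := by rw [hg]; trivial
    obtain ⟨⟨h, c⟩, hy⟩ := this
    exact ⟨h, c, by rw [← hy]; simp [g]; rfl⟩
  have lin : ∀ φ ψ : L →ₗ[ℂ] L, (∀ h : H, φ h = ψ h) → (∀ a ∈ R, φ (e a) = ψ (e a)) → φ = ψ := by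
    intro φ ψ h1 h2
    ext y
    obtain ⟨h, c, rfl⟩ := span y
    simp only [map_add, map_sum, map_smul, h1]
    congr 1
    exact Finset.sum_congr rfl fun a ha => by rw [h2 a ha]
  have expH : ∀ h : H, (h : L) = ∑ a ∈ R, a h • (t a : L) := by
    intro h
    have : h = ∑ a ∈ R, a h • t a := by
      apply (cartanEquivDual H).injective
      ext h'
      rw [map_sum, LinearMap.sum_apply]
      refine (hsum h h').trans (Finset.sum_congr rfl fun a _ => ?_)
      rw [map_smul, LinearMap.smul_apply, smul_eq_mul]
      congr 1
      exact (htK a h').symm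
    conv_lhs => rw [this]
    simp
  have ex1 : ∀ y : L, y = ∑ a ∈ R, (killingForm ℂ L y (t a) • (t a : L) + killingForm ℂ L y (f a) • e a) := by
    have := lin LinearMap.id (∑ a ∈ R, (((killingForm ℂ L).flip (t a)).smulRight (t a : L)
      + ((killingForm ℂ L).flip (f a)).smulRight (e a))) ?_ ?_
    · intro y
      simpa [hfl] using LinearMap.congr_fun this y
    · intro h
      simp only [LinearMap.id_apply, LinearMap.sum_apply, LinearMap.add_apply, LinearMap.smulRight_apply,
        hfl]
      conv_lhs => rw [expH h]
      refine Finset.sum_congr rfl fun a ha => ?_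
      rw [Ksymm, htK, kz 0 (-a) h (hH0 h) (f a) (hf a ha).1 (by simpa using ne0 a ha), zero_smul, add_zero]
    · intro b hb
      simp only [LinearMap.id_apply, LinearMap.sum_apply, LinearMap.add_apply, LinearMap.smulRight_apply,
        hfl]
      rw [Finset.sum_eq_single_of_mem b hb]
      · rw [kz b 0 _ (he b hb).1 _ (hH0 _) (by simpa using ne0 b hb), (hf b hb).2]; simp
      · intro a ha hab
        rw [kz b 0 _ (he b hb).1 _ (hH0 _) (by simpa using ne0 b hb),
          kz b (-a) _ (he b hb).1 _ (hf a ha).1 (fun h => hab (by rw [← sub_eq_add_neg, sub_eq_zero] at h; exact h.symm))]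
        simp
  have ex2 : ∀ y : L, y = ∑ a ∈ R, (killingForm ℂ L y (t a) • (t a : L) + killingForm ℂ L y (e a) • f a) := by
    have := lin LinearMap.id (∑ a ∈ R, (((killingForm ℂ L).flip (t a)).smulRight (t a : L)
      + ((killingForm ℂ L).flip (e a)).smulRight (f a))) ?_ ?_
    · intro y
      simpa [hfl] using LinearMap.congr_fun this y
    · intro h
      simp only [LinearMap.id_apply, LinearMap.sum_apply, LinearMap.add_apply, LinearMap.smulRight_apply,
        hfl]
      conv_lhs => rw [expH h]
      refine Finset.sum_congr rfl fun a ha => ?_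
      rw [Ksymm, htK, kz 0 a h (hH0 h) (e a) (he a ha).1 (by simpa using ne0 a ha), zero_smul, add_zero]
    · intro b hb
      simp only [LinearMap.id_apply, LinearMap.sum_apply, LinearMap.add_apply, LinearMap.smulRight_apply,
        hfl]
      rw [Finset.sum_eq_single_of_mem (-b) (hneg b hb)]
      · rw [kz b 0 _ (he b hb).1 _ (hH0 _) (by simpa using ne0 b hb)]
        obtain ⟨c, -, hc⟩ := fe (-b) (hneg b hb)
        rw [neg_neg] at hc
        have h1 := (hf (-b) (hneg b hb)).2
        rw [hc, map_smul, Ksymm, smul_eq_mul] at h1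
        rw [hc, smul_smul, mul_comm, h1]; simp
      · intro a ha hab
        rw [kz b 0 _ (he b hb).1 _ (hH0 _) (by simpa using ne0 b hb),
          kz b a _ (he b hb).1 _ (he a ha).1 (fun h => hab (eq_neg_of_add_eq_zero_right h))]
        simp
  refine ⟨⟨R, e, f, t, ne0, hneg, ?_, fe, ?_, span, ?_, ?_, ?_, ?_, killingForm ℂ L, Ksymm, ?_, ex1, ex2⟩⟩
  · intro a ha h
    exact lie_eq_smul_of_mem_rootSpace (he a ha).1 h
  · intro a ha
    obtain ⟨w, hw, rfl⟩ := wOf a ha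
    have := lie_eq_killingForm_smul_of_mem_rootSpace_of_mem_rootSpace_neg (α := w) (he _ ha).1 (hf _ ha).1
    rw [(hf _ ha).2, one_smul] at this
    exact this
  · intro a ha b hb hab
    have hm : ⁅e a, e b⁆ ∈ rootSpace H (a + b) :=
      lie_mem_genWeightSpace_of_mem_genWeightSpace (he a ha).1 (he b hb).1
    by_cases h0 : rootSpace H (a + b : Module.Dual ℂ H) = ⊥
    · right
      have hm' : ⁅e a, e b⁆ ∈ rootSpace H (a + b : Module.Dual ℂ H) := hm
      rw [h0] at hm'
      simpa using hm'
    · left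
      have := memR _ hab h0
      exact ⟨this, one _ this _ hm⟩
  · intro a ha
    obtain ⟨n, hn⟩ := LieAlgebra.isNilpotent_ad_of_mem_rootSpace (K := ℂ) (L := L) H (χ := a)
      (fun h => ne0 a ha (by ext z; exact congrFun h z)) (he a ha).1
    exact ⟨n, fun y => by rw [hn]; rfl⟩
  · intro a ha
    obtain ⟨w, hw, rfl⟩ := wOf a ha
    have hint : ∀ b ∈ R, ∃ n : ℤ, b (coroot w) = n := by
      intro b hb
      obtain ⟨w', hw', rfl⟩ := wOf b hb
      exact ⟨_, apply_coroot_eq_cast w w'⟩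
    have h2 : (Weight.toLinear ℂ H L w) (coroot w) = 2 := root_apply_coroot hw
    have hne : (Weight.toLinear ℂ H L w) (t w.toLinear) ≠ 0 := root_apply_cartanEquivDual_symm_ne_zero hw
    set d := (Weight.toLinear ℂ H L w) (t w.toLinear) with hd
    have hco : coroot w = (2 * d⁻¹) • t w.toLinear := by
      rw [mul_smul, ofNat_smul_eq_nsmul]; rfl
    choose! ν hν using hint
    have hK : killingForm ℂ L (coroot w) (coroot w) = ((∑ b ∈ R, ν b * ν b : ℤ) : ℂ) := by
      rw [hsum]; push_cast
      exact Finset.sum_congr rfl fun b hb => by rw [hν b hb]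
    have hK2 : killingForm ℂ L (coroot w) (coroot w) = 4 * d⁻¹ := by
      conv_lhs => enter [1]; rw [hco]
      have h3 : (((2 * d⁻¹) • t w.toLinear : H) : L) = (2 * d⁻¹) • (t w.toLinear : L) := rfl
      rw [h3, map_smul, LinearMap.smul_apply, htK, h2, smul_eq_mul]; ring
    have hpos : (0 : ℤ) < ∑ b ∈ R, ν b * ν b := by
      refine Finset.sum_pos' (fun b _ => mul_self_nonneg _) ⟨_, ha, mul_self_pos.2 ?_⟩
      intro h
      have := hν _ ha
      rw [h, h2] at this
      norm_num at this
    set n := ∑ b ∈ R, ν b * ν b with hn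
    have hnC : (n : ℂ) ≠ 0 := by exact_mod_cast hpos.ne'
    have hdn : d = 4 / n := by
      have : (n : ℂ) = 4 * d⁻¹ := by rw [← hK, hK2]
      rw [this]; field_simp
    refine ⟨2 / n, by have : (0:ℝ) < n := by exact_mod_cast hpos
                      positivity, ?_, ?_⟩
    · rw [hdn]; push_cast; ring
    · intro b hb
      refine ⟨ν b, ?_⟩
      rw [← hν b hb, hco, map_smul, smul_eq_mul, hdn]
      push_cast
      field_simp
      norm_num
  · have : Submodule.map (cartanEquivDual H).symm.toLinearMap (Submodule.span ℂ
        ({α : Weight ℂ H L | α.IsNonZero}.image (Weight.toLinear ℂ H L))) = ⊤ := by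
      rw [span_weight_isNonZero_eq_top, Submodule.map_top, LinearEquiv.range]
    rw [Submodule.map_span] at this
    rw [← this]
    congr 1
    ext x
    constructor
    · rintro ⟨a, ha, rfl⟩
      obtain ⟨w, hw, rfl⟩ := wOf a ha
      exact ⟨_, ⟨w, hw, rfl⟩, rfl⟩
    · rintro ⟨_, ⟨w, hw, rfl⟩, rfl⟩
      exact ⟨_, memW w hw, rfl⟩
  · intro y a b
    have := LieModule.traceForm_apply_lie_apply' ℂ L L y a b
    exact this

end Killing

section Fin

theorem acc_step {α : Type*} [Lattice α] [IsModularLattice α] {y : α}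
    (hy : Acc (· < ·) y) : ∀ x, y ⋖ x → Acc (· < ·) x := by
  induction hy with
  | intro y h ih =>
    intro x hyx
    refine Acc.intro x fun z hz => ?_
    by_cases hzy : z ≤ y
    · rcases hzy.lt_or_eq with h' | rfl
      · exact h z h'
      · exact Acc.intro _ h
    · have hsup : z ⊔ y = x := by
        rcases hyx.eq_or_eq (c := z ⊔ y) le_sup_right (sup_le hz.le hyx.le) with h' | h'
        · exact absurd (sup_eq_right.1 h') hzy
        · exact h'
      have hcov : z ⊓ y ⋖ z := inf_covBy_of_covBy_sup_right (by rwa [hsup])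
      refine ih (z ⊓ y) ?_ z hcov
      refine lt_of_le_of_ne inf_le_right fun he => ?_
      rcases hyx.eq_or_eq (c := z) (inf_eq_right.1 he) hz.le with h' | h'
      · exact hzy h'.le
      · exact hz.ne h'

theorem lattice_fin {α : Type*} [Lattice α] [BoundedOrder α] [IsModularLattice α]
    [WellFoundedGT α] (h : ∀ K : α, K ≠ ⊤ → ∃ K', K ⋖ K') :
    WellFoundedLT α ∧ ∃ (n : ℕ) (c : Fin (n + 1) → α),
      c 0 = ⊥ ∧ c (Fin.last n) = ⊤ ∧ ∀ i : Fin n, c i.castSucc ⋖ c i.succ := by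
  let P : Set α := {K | Acc (· < ·) K ∧ ∃ (n : ℕ) (c : Fin (n + 1) → α),
      c 0 = ⊥ ∧ c (Fin.last n) = K ∧ ∀ i : Fin n, c i.castSucc ⋖ c i.succ}
  have hP : P.Nonempty := ⟨⊥, Acc.intro _ fun z hz => absurd hz not_lt_bot, 0, fun _ => ⊥, rfl, rfl,
    fun i => i.elim0⟩
  obtain ⟨K, ⟨hacc, n, c, hc0, hcl, hcc⟩, hmax⟩ :=
    (wellFounded_gt (α := α)).has_min P hP
  have hK : K = ⊤ := by
    by_contra hK
    obtain ⟨K', hK'⟩ := h K hK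
    refine hmax K' ⟨acc_step hacc K' hK', n + 1, Fin.snoc (α := fun _ => α) c K', ?_, ?_, ?_⟩ hK'.lt
    · have : (0 : Fin (n + 1 + 1)) = Fin.castSucc 0 := rfl
      rw [this, Fin.snoc_castSucc, hc0]
    · rw [Fin.snoc_last]
    · intro i
      refine Fin.lastCases ?_ (fun j => ?_) i
      · rw [Fin.snoc_castSucc, Fin.succ_last, Fin.snoc_last, hcl]; exact hK'
      · rw [Fin.snoc_castSucc, Fin.succ_castSucc, Fin.snoc_castSucc]; exact hcc j
  subst hK
  refine ⟨⟨⟨fun x => ?_⟩⟩, n, c, hc0, hcl, hcc⟩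
  rcases (le_top : x ≤ ⊤).lt_or_eq with h' | h'
  · exact hacc.inv h'
  · rw [h']; exact hacc

theorem exists_cov {L : Type*} [LieRing L] [LieAlgebra ℂ L] {H : LieSubalgebra ℂ L} (D : RD H)
    (M : Type*) [AddCommGroup M] [Module ℂ M] [LieRingModule L M] [LieModule ℂ L M]
    (hwt : IsWt H (LieModule.toEnd ℂ L M : L →ₗ[ℂ] Module.End ℂ M))
    (K : LieSubmodule ℂ L M) (hK : K ≠ ⊤) : ∃ K', K ⋖ K' := by
  have hρ : IsRep (LieModule.toEnd ℂ L M : L →ₗ[ℂ] Module.End ℂ M) := by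
    intro x y v; simp
  have hW : Stb (LieModule.toEnd ℂ L M : L →ₗ[ℂ] Module.End ℂ M) K.toSubmodule :=
    fun y w hw => K.lie_mem hw
  have : Nontrivial (M ⧸ K.toSubmodule) := by
    rw [Submodule.Quotient.nontrivial_iff]
    intro h; exact hK (by simpa using h)
  obtain ⟨T, hT⟩ := D.exists_min (hρ.rquo _ hW) (hwt.rquo _ hW)
  let K' : LieSubmodule ℂ L M :=
    { T.comap K.toSubmodule.mkQ with
      lie_mem := by
        intro x m hm
        exact hT.1 x _ hm }
  have hKK' : K ≤ K' := by
    intro m hm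
    change K.toSubmodule.mkQ m ∈ T
    rw [(Submodule.Quotient.mk_eq_zero K.toSubmodule).2 hm |> fun h => (h : K.toSubmodule.mkQ m = 0)]
    exact T.zero_mem
  refine ⟨K', lt_of_le_of_ne hKK' ?_, ?_⟩
  · intro h
    apply hT.2.1
    rw [eq_bot_iff]
    intro v hv
    obtain ⟨m, rfl⟩ := K.toSubmodule.mkQ_surjective v
    have : m ∈ K' := hv
    rw [← h] at this
    exact (Submodule.Quotient.mk_eq_zero K.toSubmodule).2 this
  · intro X hKX hXK'
    have h1 : T ≤ X.toSubmodule.map K.toSubmodule.mkQ := by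
      refine hT.2.2 _ ?_ ?_ ?_
      · rintro _ ⟨m, hm, rfl⟩
        exact hXK'.le hm
      · rintro y _ ⟨m, hm, rfl⟩
        exact ⟨⁅y, m⁆, X.lie_mem hm, rfl⟩
      · intro h
        refine hKX.not_ge fun m hm => ?_
        have : K.toSubmodule.mkQ m ∈ X.toSubmodule.map K.toSubmodule.mkQ := ⟨m, hm, rfl⟩
        rw [h, Submodule.mem_bot] at this
        exact (Submodule.Quotient.mk_eq_zero K.toSubmodule).1 this
    refine hXK'.not_ge fun m hm => ?_
    obtain ⟨m', hm', he⟩ := h1 (show K.toSubmodule.mkQ m ∈ T from hm)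
    have h2 : m - m' ∈ K := (Submodule.Quotient.eq K.toSubmodule).1 he.symm
    have := add_mem (hKX.le h2) (show m' ∈ X from hm')
    rwa [sub_add_cancel] at this

end Fin

/-- Every module in `O_{S,θ}` is Noetherian and Artinian, and
admits a finite Jordan–Hölder series. -/
theorem inO_noetherian_artinian_jordanHolder
    {L : Type*} [LieRing L] [LieAlgebra ℂ L] [FiniteDimensional ℂ L]
    [LieAlgebra.IsSimple ℂ L]
    (H : LieSubalgebra ℂ L) [H.IsCartanSubalgebra]
    (Δ : Finset (Module.Dual ℂ H)) (hΔ : IsBase H Δ)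
    (S θ : Finset (Module.Dual ℂ H)) (hθS : θ ⊆ S) (hS : S ⊆ Δ)
    (M : Type*) [AddCommGroup M] [Module ℂ M] [LieRingModule L M] [LieModule ℂ L M]
    (hM : InO H Δ S θ M) :
    WellFoundedGT (LieSubmodule ℂ L M) ∧ WellFoundedLT (LieSubmodule ℂ L M) ∧
    ∃ (n : ℕ) (c : Fin (n + 1) → LieSubmodule ℂ L M),
      c 0 = ⊥ ∧ c (Fin.last n) = ⊤ ∧ ∀ i : Fin n, c i.castSucc ⋖ c i.succ := by
  obtain ⟨⟨s, hs⟩, hsup, hfd⟩ := hM.1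
  have hgt := lieSubmodule_noeth M s hs
  have hwt : IsWt H (LieModule.toEnd ℂ L M : L →ₗ[ℂ] Module.End ℂ M) := ⟨hsup, hfd⟩
  obtain ⟨D⟩ := exists_RD H
  exact ⟨hgt, lattice_fin (exists_cov D M hwt)⟩

end Paper
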